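/- Let q₁, q₂ ∈ L¹(0,π) be real-valued, let f₁, f₂ be rational Herglotz–Nevanlinna functions, let k ≥ 1 be a fixed natural number, and let (b_j)_{j∈ℕ} be a sequence of pairwise distinct real numbers. Suppose that for each j there exist enumerations Λ₁ʲ and Λ₂ʲ of the eigenvalues of the problems P(q₁,f₁,b_j) and P(q₂,f₂,b_j) respectively, and that Λ₁ʲ(k) = Λ₂ʲ(k) for every j. Then q₁(x) = q₂(x) for almost every x ∈ (0,π) and f₁ = f₂. -/

import Mathlib

open MeasureTheory Set

noncomputable section

/-- A rational Herglotz–Nevanlinna function, given by its canonical data: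
`f(λ) = a·λ + c + Σ_j γ_j / (β_j − λ)` with `a ≥ 0`, `γ_j > 0` and `β_1 < … < β_n`. -/
structure RatHN where
  a : ℝ
  c : ℝ
  n : ℕ
  γ : Fin n → ℝ
  β : Fin n → ℝ
  ha : 0 ≤ a
  hγ : ∀ j, 0 < γ j
  hβ : StrictMono β

namespace RatHN

/-- The value `f(λ)` of a rational Herglotz–Nevanlinna function. -/
def eval (f : RatHN) (lam : ℝ) : ℝ :=
  f.a * lam + f.c + ∑ j : Fin f.n, f.γ j / (f.β j - lam)

/-- `lam` is a pole of `f`. -/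
def IsPole (f : RatHN) (lam : ℝ) : Prop := ∃ j, f.β j = lam

end RatHN

/-- A (Carathéodory) solution of `−y″ + Q·y = λ·y` on `[0, L]`:
a pair of continuous functions `y, y'` satisfying the two integral equations. -/
def IsCaraSol (Q : ℝ → ℝ) (L lam : ℝ) (y y' : ℝ → ℝ) : Prop :=
  ContinuousOn y (Icc 0 L) ∧ ContinuousOn y' (Icc 0 L) ∧
  (∀ x ∈ Icc (0:ℝ) L, y x = y 0 + ∫ t in (0:ℝ)..x, y' t) ∧
  (∀ x ∈ Icc (0:ℝ) L, y' x = y' 0 + ∫ t in (0:ℝ)..x, (Q t - lam) * y t)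

/-- `lam` is an eigenvalue of the problem `P(q, f, b)`, where `b : Option ℝ`
and `none` stands for the Dirichlet condition (`b = ∞`) at the right endpoint. -/
def IsEigen (q : ℝ → ℝ) (f : RatHN) (b : Option ℝ) (lam : ℝ) : Prop :=
  ∃ y y' : ℝ → ℝ, IsCaraSol q Real.pi lam y y' ∧
    (∃ x ∈ Icc (0:ℝ) Real.pi, y x ≠ 0) ∧
    (¬ f.IsPole lam → y' 0 = -f.eval lam * y 0) ∧
    (f.IsPole lam → y 0 = 0) ∧
    (∀ bb : ℝ, b = some bb → y' Real.pi = bb * y Real.pi) ∧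
    (b = none → y Real.pi = 0)

/-- The set of eigenvalues of the problem `P(q, f, b)`. -/
def eigenvalues (q : ℝ → ℝ) (f : RatHN) (b : Option ℝ) : Set ℝ :=
  {lam | IsEigen q f b lam}

/-- `Λ` is an enumeration of the set `S`: a strictly increasing sequence whose
range is exactly `S`. -/
def IsEnum (S : Set ℝ) (Λ : ℕ → ℝ) : Prop :=
  StrictMono Λ ∧ Set.range Λ = S

namespace SturmLiouville

open BoundedContinuousFunction

variable {𝕜 : Type*} [RCLike 𝕜]

/-- The projection of `ℝ` onto `[0, π]`. -/
def clamp (x : ℝ) : ℝ := max 0 (min x Real.pi)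

lemma clamp_mem (x : ℝ) : clamp x ∈ Icc (0 : ℝ) Real.pi :=
  ⟨le_max_left _ _, max_le Real.pi_pos.le (min_le_right _ _)⟩

lemma clamp_of_mem {x : ℝ} (hx : x ∈ Icc (0 : ℝ) Real.pi) : clamp x = x := by
  rw [clamp, min_eq_left hx.2, max_eq_right hx.1]

lemma continuous_clamp : Continuous clamp := by unfold clamp; fun_prop

lemma intervalIntegrable_sub {E : Type*} [NormedAddCommGroup E] {k : ℝ → E}
    (hk : IntervalIntegrable k volume 0 Real.pi) {x : ℝ} (hx : x ∈ Icc (0 : ℝ) Real.pi) :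
    IntervalIntegrable k volume 0 x := by
  refine hk.mono_set ?_
  rw [uIcc_of_le hx.1, uIcc_of_le Real.pi_pos.le]
  exact Icc_subset_Icc_right hx.2

lemma norm_integral_mul_le {k g : ℝ → 𝕜} {M : ℝ}
    (hk : IntervalIntegrable k volume 0 Real.pi) {x : ℝ} (hx : x ∈ Icc (0 : ℝ) Real.pi)
    (hM : 0 ≤ M) (hg : ∀ t ∈ Icc 0 x, ‖g t‖ ≤ M) :
    ‖∫ t in (0 : ℝ)..x, k t * g t‖ ≤ (∫ t in (0 : ℝ)..Real.pi, ‖k t‖) * M := by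
  calc ‖∫ t in (0 : ℝ)..x, k t * g t‖ ≤ ∫ t in (0 : ℝ)..x, ‖k t‖ * M := by
        refine intervalIntegral.norm_integral_le_of_norm_le hx.1 ?_
          ((intervalIntegrable_sub hk hx).norm.mul_const M)
        refine Filter.Eventually.of_forall fun t ht => ?_
        rw [norm_mul]
        exact mul_le_mul_of_nonneg_left (hg t ⟨ht.1.le, ht.2⟩) (norm_nonneg _)
    _ = (∫ t in (0 : ℝ)..x, ‖k t‖) * M := intervalIntegral.integral_mul_const _ _
    _ ≤ (∫ t in (0 : ℝ)..Real.pi, ‖k t‖) * M := by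
        refine mul_le_mul_of_nonneg_right ?_ hM
        refine intervalIntegral.integral_mono_interval le_rfl hx.1 hx.2 ?_ hk.norm
        exact Filter.Eventually.of_forall fun t => norm_nonneg _

lemma continuous_integral_clamp {k : ℝ → 𝕜} (hk : IntervalIntegrable k volume 0 Real.pi) :
    Continuous fun x => ∫ t in (0 : ℝ)..clamp x, k t := by
  have h := intervalIntegral.continuousOn_primitive_interval
    (hk.1.congr_set_ae Ioc_ae_eq_Icc.symm |> fun h => by
      rwa [← uIcc_of_le Real.pi_pos.le] at h)
  rw [uIcc_of_le Real.pi_pos.le] at h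
  exact h.comp_continuous continuous_clamp clamp_mem

/-- The operator `g ↦ ∫₀ˣ k g` on bounded continuous functions. -/
def prim (k : ℝ → 𝕜) (hk : IntervalIntegrable k volume 0 Real.pi) :
    (ℝ →ᵇ 𝕜) →L[𝕜] (ℝ →ᵇ 𝕜) :=
  LinearMap.mkContinuous
    { toFun := fun g => ofNormedAddCommGroup (fun x => ∫ t in (0 : ℝ)..clamp x, k t * g t)
        (continuous_integral_clamp (hk.mul_continuousOn g.continuous.continuousOn))
        ((∫ t in (0 : ℝ)..Real.pi, ‖k t‖) * ‖g‖)
        (fun x => norm_integral_mul_le hk (clamp_mem x) (norm_nonneg _)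
          fun t _ => g.norm_coe_le_norm t)
      map_add' := fun g h => by
        ext x
        simp only [coe_ofNormedAddCommGroup, BoundedContinuousFunction.add_apply, mul_add]
        have hk' := intervalIntegrable_sub hk (clamp_mem x)
        exact intervalIntegral.integral_add (hk'.mul_continuousOn g.continuous.continuousOn)
          (hk'.mul_continuousOn h.continuous.continuousOn)
      map_smul' := fun c g => by
        ext x
        simp only [coe_ofNormedAddCommGroup, BoundedContinuousFunction.smul_apply, smul_eq_mul,
          RingHom.id_apply]
        rw [← intervalIntegral.integral_const_mul]
        congr 1
        ext t
        ring }
    (∫ t in (0 : ℝ)..Real.pi, ‖k t‖)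
    (fun g => norm_ofNormedAddCommGroup_le
      (continuous_integral_clamp (hk.mul_continuousOn g.continuous.continuousOn))
      (mul_nonneg (intervalIntegral.integral_nonneg Real.pi_pos.le fun _ _ => norm_nonneg _)
        (norm_nonneg _))
      (fun x => norm_integral_mul_le hk (clamp_mem x) (norm_nonneg _)
          fun t _ => g.norm_coe_le_norm t))

lemma prim_apply {k : ℝ → 𝕜} (hk : IntervalIntegrable k volume 0 Real.pi) (g : ℝ →ᵇ 𝕜) (x : ℝ) :
    prim k hk g x = ∫ t in (0 : ℝ)..clamp x, k t * g t := rfl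

/-- The weight `exp (c x)` on `[0, π]`, extended by constants. -/
def weight (𝕜 : Type*) [RCLike 𝕜] (c : ℝ) : ℝ →ᵇ 𝕜 :=
  ofNormedAddCommGroup (fun x => ((Real.exp (c * clamp x) : ℝ) : 𝕜))
    (RCLike.continuous_ofReal.comp (by have := continuous_clamp; fun_prop))
    (Real.exp (|c| * Real.pi)) (fun x => by
      rw [RCLike.norm_ofReal, abs_of_pos (Real.exp_pos _)]
      refine Real.exp_le_exp.2 ((mul_le_mul_of_nonneg_right (le_abs_self c) (clamp_mem x).1).trans
        (mul_le_mul_of_nonneg_left (clamp_mem x).2 (abs_nonneg c))))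

lemma weight_apply (c x : ℝ) : weight 𝕜 c x = ((Real.exp (c * clamp x) : ℝ) : 𝕜) := rfl

lemma weight_mul_neg (c : ℝ) : weight 𝕜 c * weight 𝕜 (-c) = 1 := by
  ext x
  rw [BoundedContinuousFunction.mul_apply, weight_apply, weight_apply, ← RCLike.ofReal_mul,
    ← Real.exp_add]
  simp

/-- For the integral operator `V` of the Sturm–Liouville Volterra equation, the operator
`1 - V` is invertible. -/
lemma isUnit_one_sub_prim {k : ℝ → 𝕜} (hk : IntervalIntegrable k volume 0 Real.pi) :
    IsUnit (1 - prim (fun _ => (1 : 𝕜)) intervalIntegrable_const * prim k hk) := by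
  set A := ∫ t in (0 : ℝ)..Real.pi, ‖k t‖ with hA
  have hA0 : 0 ≤ A := intervalIntegral.integral_nonneg Real.pi_pos.le fun _ _ => norm_nonneg _
  set c := A + 1
  have hc : 0 < c := by positivity
  set P := prim (fun _ => (1 : 𝕜)) intervalIntegrable_const
  set K := prim k hk
  set W := ContinuousLinearMap.mul 𝕜 (ℝ →ᵇ 𝕜) (weight 𝕜 c) with hW
  set W' := ContinuousLinearMap.mul 𝕜 (ℝ →ᵇ 𝕜) (weight 𝕜 (-c)) with hW'
  have hWW' : W * W' = 1 := by
    ext1 g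
    simp only [hW, hW', ContinuousLinearMap.mul_apply', mul_apply_eq_comp,
      ← mul_assoc, weight_mul_neg, one_mul, one_apply_eq_self]
  have hW'W : W' * W = 1 := by
    ext1 g
    have := weight_mul_neg (𝕜 := 𝕜) (-c)
    rw [neg_neg] at this
    simp only [hW, hW', ContinuousLinearMap.mul_apply', mul_apply_eq_comp,
      ← mul_assoc, this, one_mul, one_apply_eq_self]
  have hwg : ∀ (g : ℝ →ᵇ 𝕜) (x : ℝ), ∀ t ∈ Icc 0 (clamp x),
      ‖(W g) t‖ ≤ Real.exp (c * t) * ‖g‖ := by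
    intro g x t ht
    have : clamp t = t := clamp_of_mem ⟨ht.1, ht.2.trans (clamp_mem x).2⟩
    rw [hW, ContinuousLinearMap.mul_apply', BoundedContinuousFunction.mul_apply, norm_mul,
      weight_apply, RCLike.norm_ofReal, abs_of_pos (Real.exp_pos _), this]
    exact mul_le_mul_of_nonneg_left (g.norm_coe_le_norm t) (Real.exp_pos _).le
  have hw' : ∀ (g : ℝ →ᵇ 𝕜) (x : ℝ), ‖(W' g) x‖ = Real.exp (-c * clamp x) * ‖g x‖ := by
    intro g x
    rw [hW', ContinuousLinearMap.mul_apply', BoundedContinuousFunction.mul_apply, norm_mul,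
      weight_apply, RCLike.norm_ofReal, abs_of_pos (Real.exp_pos _)]
  have hP : ‖W' * P * W‖ ≤ 1 / c := by
    refine ContinuousLinearMap.opNorm_le_bound _ (by positivity) fun g => ?_
    refine (BoundedContinuousFunction.norm_le (by positivity)).2 fun x => ?_
    rw [mul_apply_eq_comp, mul_apply_eq_comp, hw', prim_apply]
    have h1 : ‖∫ t in (0 : ℝ)..clamp x, 1 * (W g) t‖ ≤
        ∫ t in (0 : ℝ)..clamp x, Real.exp (c * t) * ‖g‖ := by
      refine intervalIntegral.norm_integral_le_of_norm_le (clamp_mem x).1 ?_ ?_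
      · refine Filter.Eventually.of_forall fun t ht => ?_
        rw [one_mul]
        exact hwg g x t ⟨ht.1.le, ht.2⟩
      · exact Continuous.intervalIntegrable (by fun_prop) _ _
    have h2 : ∫ t in (0 : ℝ)..clamp x, Real.exp (c * t) * ‖g‖ =
        (Real.exp (c * clamp x) - 1) / c * ‖g‖ := by
      rw [intervalIntegral.integral_mul_const, intervalIntegral.integral_comp_mul_left _ hc.ne',
        integral_exp, smul_eq_mul, mul_zero, Real.exp_zero]
      field_simp
    rw [h2] at h1
    calc _ ≤ Real.exp (-c * clamp x) * ((Real.exp (c * clamp x) - 1) / c * ‖g‖) :=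
          mul_le_mul_of_nonneg_left h1 (Real.exp_pos _).le
      _ = (1 - Real.exp (-c * clamp x)) / c * ‖g‖ := by
          have : Real.exp (-c * clamp x) * Real.exp (c * clamp x) = 1 := by
            rw [← Real.exp_add]; simp
          linear_combination ‖g‖ / c * this
      _ ≤ 1 / c * ‖g‖ := by
          have := Real.exp_pos (-c * clamp x)
          gcongr
          linarith
  have hK : ‖W' * K * W‖ ≤ A := by
    refine ContinuousLinearMap.opNorm_le_bound _ hA0 fun g => ?_
    refine (BoundedContinuousFunction.norm_le (by positivity)).2 fun x => ?_
    rw [mul_apply_eq_comp, mul_apply_eq_comp, hw', prim_apply]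
    have h1 := norm_integral_mul_le hk (clamp_mem x) (g := W g)
      (M := Real.exp (c * clamp x) * ‖g‖) (by positivity) fun t ht =>
        (hwg g x t ht).trans (by have := ht.2; gcongr)
    calc _ ≤ Real.exp (-c * clamp x) * (A * (Real.exp (c * clamp x) * ‖g‖)) :=
          mul_le_mul_of_nonneg_left h1 (Real.exp_pos _).le
      _ = A * ‖g‖ := by
          have : Real.exp (-c * clamp x) * Real.exp (c * clamp x) = 1 := by
            rw [← Real.exp_add]; simp
          linear_combination A * ‖g‖ * this
  have hM : ‖W' * (P * K) * W‖ < 1 := by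
    have : W' * (P * K) * W = (W' * P * W) * (W' * K * W) := by
      calc W' * (P * K) * W = W' * P * 1 * K * W := by simp only [mul_assoc, one_mul]
        _ = _ := by rw [← hWW']; simp only [mul_assoc]
    rw [this]
    calc _ ≤ ‖W' * P * W‖ * ‖W' * K * W‖ := norm_mul_le _ _
      _ ≤ 1 / c * A := by gcongr
      _ < 1 := by rw [one_div, inv_mul_lt_iff₀ hc]; simp [c]
  have h1 := isUnit_one_sub_of_norm_lt_one hM
  have h2 : 1 - P * K = W * (1 - W' * (P * K) * W) * W' := by
    rw [mul_sub, sub_mul, mul_one, hWW']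
    congr 1
    calc P * K = 1 * (P * K) * 1 := by simp
      _ = _ := by rw [← hWW']; simp only [mul_assoc]
  rw [h2]
  exact ((Units.mk W W' hWW' hW'W).isUnit.mul h1).mul (Units.mk W' W hW'W hWW').isUnit

end SturmLiouville

namespace SturmLiouville

open BoundedContinuousFunction

variable {𝕜 : Type*} [RCLike 𝕜]

/-- Carathéodory solutions of `-y'' + q y = λ y` on `[0, π]` with values in `𝕜`. -/
def IsSol (q : ℝ → ℝ) (lam : 𝕜) (y y' : ℝ → 𝕜) : Prop :=
  ContinuousOn y (Icc 0 Real.pi) ∧ ContinuousOn y' (Icc 0 Real.pi) ∧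
  (∀ x ∈ Icc (0 : ℝ) Real.pi, y x = y 0 + ∫ t in (0 : ℝ)..x, y' t) ∧
  (∀ x ∈ Icc (0 : ℝ) Real.pi, y' x = y' 0 + ∫ t in (0 : ℝ)..x, ((q t : 𝕜) - lam) * y t)

lemma isCaraSol_iff_isSol {q : ℝ → ℝ} {lam : ℝ} {y y' : ℝ → ℝ} :
    IsCaraSol q Real.pi lam y y' ↔ IsSol q lam y y' := by
  simp [IsCaraSol, IsSol]

lemma IsSol.ofReal {q : ℝ → ℝ} {lam : ℝ} {y y' : ℝ → ℝ} (h : IsSol q lam y y') :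
    IsSol q (lam : ℂ) (fun x => (y x : ℂ)) (fun x => (y' x : ℂ)) := by
  obtain ⟨h1, h2, h3, h4⟩ := h
  refine ⟨Complex.continuous_ofReal.comp_continuousOn h1,
    Complex.continuous_ofReal.comp_continuousOn h2, fun x hx => ?_, fun x hx => ?_⟩
  · beta_reduce
    rw [h3 x hx, Complex.ofReal_add, intervalIntegral.integral_ofReal]
  · beta_reduce
    rw [h4 x hx, Complex.ofReal_add, ← intervalIntegral.integral_ofReal]
    simp

lemma intervalIntegrable_pot {q : ℝ → ℝ} (hq : IntervalIntegrable q volume 0 Real.pi) (lam : 𝕜) :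
    IntervalIntegrable (fun t => (q t : 𝕜) - lam) volume 0 Real.pi :=
  IntervalIntegrable.sub ⟨hq.1.ofReal, hq.2.ofReal⟩ intervalIntegrable_const

/-- The operator `g ↦ ∫₀ˣ g`. -/
abbrev primOne (𝕜 : Type*) [RCLike 𝕜] : (ℝ →ᵇ 𝕜) →L[𝕜] (ℝ →ᵇ 𝕜) :=
  prim (fun _ => (1 : 𝕜)) intervalIntegrable_const

/-- The operator `g ↦ ∫₀ˣ (q - λ) g`. -/
abbrev primPot {q : ℝ → ℝ} (hq : IntervalIntegrable q volume 0 Real.pi) (lam : 𝕜) :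
    (ℝ →ᵇ 𝕜) →L[𝕜] (ℝ →ᵇ 𝕜) :=
  prim (fun t => (q t : 𝕜) - lam) (intervalIntegrable_pot hq lam)

/-- The solution of `-y'' + q y = λ y` with `y(0) = a`, `y'(0) = b`. -/
def sol {q : ℝ → ℝ} (hq : IntervalIntegrable q volume 0 Real.pi) (lam a b : 𝕜) : ℝ →ᵇ 𝕜 :=
  Ring.inverse (1 - primOne 𝕜 * primPot hq lam) (a • 1 + b • primOne 𝕜 1)

/-- The derivative of `sol`. -/
def dsol {q : ℝ → ℝ} (hq : IntervalIntegrable q volume 0 Real.pi) (lam a b : 𝕜) : ℝ →ᵇ 𝕜 :=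
  b • 1 + primPot hq lam (sol hq lam a b)

section

variable {q : ℝ → ℝ} (hq : IntervalIntegrable q volume 0 Real.pi)

lemma eq_sol_iff (lam a b : 𝕜) (g : ℝ →ᵇ 𝕜) :
    g = sol hq lam a b ↔ g = a • 1 + primOne 𝕜 (b • 1 + primPot hq lam g) := by
  have hu := isUnit_one_sub_prim (intervalIntegrable_pot hq lam)
  have h1 : g = a • 1 + primOne 𝕜 (b • 1 + primPot hq lam g) ↔
      (1 - primOne 𝕜 * primPot hq lam) g = a • 1 + b • primOne 𝕜 1 := by
    rw [_root_.sub_apply, mul_apply_eq_comp, map_add, map_smul, sub_eq_iff_eq_add,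
      one_apply_eq_self, add_assoc]
  rw [h1, sol]
  constructor
  · rintro rfl
    rw [← mul_apply_eq_comp, Ring.mul_inverse_cancel _ hu, one_apply_eq_self]
  · intro h
    rw [← h, ← mul_apply_eq_comp, Ring.inverse_mul_cancel _ hu, one_apply_eq_self]

lemma sol_eq (lam a b : 𝕜) : sol hq lam a b = a • 1 + primOne 𝕜 (dsol hq lam a b) :=
  (eq_sol_iff hq lam a b _).1 rfl

lemma clamp_zero : clamp 0 = 0 := clamp_of_mem ⟨le_rfl, Real.pi_pos.le⟩

@[simp] lemma sol_zero (lam a b : 𝕜) : sol hq lam a b 0 = a := by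
  rw [sol_eq]; simp [prim_apply, clamp_zero]

@[simp] lemma dsol_zero (lam a b : 𝕜) : dsol hq lam a b 0 = b := by
  simp [dsol, prim_apply, clamp_zero]

lemma isSol_sol (lam a b : 𝕜) : IsSol q lam (sol hq lam a b) (dsol hq lam a b) := by
  refine ⟨(sol hq lam a b).continuous.continuousOn, (dsol hq lam a b).continuous.continuousOn,
    fun x hx => ?_, fun x hx => ?_⟩
  · rw [sol_zero]
    conv_lhs => rw [sol_eq]
    simp [prim_apply, clamp_of_mem hx]
  · rw [dsol_zero]
    conv_lhs => rw [dsol]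
    simp [prim_apply, clamp_of_mem hx]

/-- Extension by constants of a continuous function on `[0, π]`. -/
lemma exists_extension {y : ℝ → 𝕜} (hy : ContinuousOn y (Icc 0 Real.pi)) :
    ∃ g : ℝ →ᵇ 𝕜, ∀ x, g x = y (clamp x) := by
  obtain ⟨C, hC⟩ := isCompact_Icc.exists_bound_of_continuousOn hy
  exact ⟨ofNormedAddCommGroup (fun x => y (clamp x)) (hy.comp_continuous continuous_clamp clamp_mem)
    C fun x => hC _ (clamp_mem x), fun x => rfl⟩

lemma integral_congr_clamp {k g : ℝ → 𝕜} {x : ℝ} (hx : x ∈ Icc (0 : ℝ) Real.pi) :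
    ∫ t in (0 : ℝ)..x, k t * g (clamp t) = ∫ t in (0 : ℝ)..x, k t * g t := by
  refine intervalIntegral.integral_congr fun t ht => ?_
  rw [uIcc_of_le hx.1] at ht
  rw [clamp_of_mem ⟨ht.1, ht.2.trans hx.2⟩]

lemma IsSol.eq_sol {lam : 𝕜} {y y' : ℝ → 𝕜} (h : IsSol q lam y y') {x : ℝ}
    (hx : x ∈ Icc (0 : ℝ) Real.pi) :
    y x = sol hq lam (y 0) (y' 0) x ∧ y' x = dsol hq lam (y 0) (y' 0) x := by
  obtain ⟨h1, h2, h3, h4⟩ := h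
  obtain ⟨g, hg⟩ := exists_extension h1
  obtain ⟨g', hg'⟩ := exists_extension h2
  have e2 : g' = y' 0 • 1 + primPot hq lam g := by
    ext x
    have hx := clamp_mem x
    rw [hg', h4 _ hx]
    simp only [BoundedContinuousFunction.add_apply, prim_apply, hg]
    rw [integral_congr_clamp hx]
    simp
  have e1 : g = y 0 • 1 + primOne 𝕜 g' := by
    ext x
    have hx := clamp_mem x
    rw [hg, h3 _ hx]
    simp only [BoundedContinuousFunction.add_apply, prim_apply, hg']
    rw [integral_congr_clamp hx]
    simp
  have e3 : g = sol hq lam (y 0) (y' 0) := by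
    rw [eq_sol_iff, ← e2]; exact e1
  have hgx := hg x
  have hgx' := hg' x
  rw [clamp_of_mem hx] at hgx hgx'
  refine ⟨by rw [← hgx, ← e3], ?_⟩
  rw [← hgx', dsol, ← e3, ← e2]

lemma sol_linear (lam a b : 𝕜) :
    sol hq lam a b = a • sol hq lam 1 0 + b • sol hq lam 0 1 := by
  simp [sol, map_add, map_smul]

lemma dsol_linear (lam a b : 𝕜) :
    dsol hq lam a b = a • dsol hq lam 1 0 + b • dsol hq lam 0 1 := by
  simp only [dsol]
  rw [sol_linear hq lam a b]
  simp only [map_add, map_smul, smul_add, zero_smul, one_smul, zero_add]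
  abel

lemma primPot_eq (lam : 𝕜) : primPot hq lam = primPot hq (0 : 𝕜) - lam • primOne 𝕜 := by
  ext g x
  have hk := intervalIntegrable_sub (intervalIntegrable_pot hq (0 : 𝕜)) (clamp_mem x)
  have hg := g.continuous.continuousOn (s := uIcc 0 (clamp x))
  simp only [_root_.sub_apply, BoundedContinuousFunction.sub_apply, prim_apply,
    _root_.smul_apply, BoundedContinuousFunction.smul_apply, smul_eq_mul]
  rw [← intervalIntegral.integral_const_mul, ← intervalIntegral.integral_sub
    (hk.mul_continuousOn hg) ((hg.intervalIntegrable).const_mul _ |> fun h => by simpa using h)]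
  congr 1
  ext t
  ring

lemma analyticAt_sol (a b lam : 𝕜) : AnalyticAt 𝕜 (fun z => sol hq z a b) lam := by
  have h1 : AnalyticAt 𝕜 (fun z : 𝕜 => 1 - primOne 𝕜 * primPot hq z) lam := by
    have h : (fun z : 𝕜 => 1 - primOne 𝕜 * primPot hq z) =
        fun z => 1 - primOne 𝕜 * primPot hq 0 + z • (primOne 𝕜 * primOne 𝕜) := by
      ext1 z
      rw [primPot_eq hq z]
      ext1 g
      simp only [_root_.sub_apply, _root_.add_apply, _root_.smul_apply, mul_apply_eq_comp, map_sub,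
        map_smul]
      abel
    rw [h]
    exact analyticAt_const.add (analyticAt_id.smul analyticAt_const)
  have hu := isUnit_one_sub_prim (intervalIntegrable_pot hq lam)
  have h2 : AnalyticAt 𝕜 (fun z : 𝕜 => Ring.inverse (1 - primOne 𝕜 * primPot hq z)) lam := by
    have h := analyticAt_inverse (𝕜 := 𝕜) (A := (ℝ →ᵇ 𝕜) →L[𝕜] (ℝ →ᵇ 𝕜)) hu.unit
    rw [hu.unit_spec] at h
    exact AnalyticAt.comp (f := fun z : 𝕜 => 1 - primOne 𝕜 * primPot hq z) h h1
  exact ((ContinuousLinearMap.apply 𝕜 (ℝ →ᵇ 𝕜) (a • 1 + b • primOne 𝕜 1)).analyticAt _).comp h2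

lemma analyticAt_dsol (a b lam : 𝕜) : AnalyticAt 𝕜 (fun z => dsol hq z a b) lam := by
  have := analyticAt_sol hq a b lam
  have h : (fun z => dsol hq z a b) = fun z => b • 1 + (primPot hq 0 (sol hq z a b) -
      z • primOne 𝕜 (sol hq z a b)) := by
    ext1 z
    rw [dsol, primPot_eq hq z, _root_.sub_apply, _root_.smul_apply]
  rw [h]
  have h1 : ∀ L : (ℝ →ᵇ 𝕜) →L[𝕜] (ℝ →ᵇ 𝕜), AnalyticAt 𝕜 (fun z => L (sol hq z a b)) lam :=
    fun L => (L.analyticAt _).comp this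
  exact analyticAt_const.add ((h1 _).sub (analyticAt_id.smul (h1 _)))

lemma analyticAt_eval {F : 𝕜 → (ℝ →ᵇ 𝕜)} {lam : 𝕜} (hF : AnalyticAt 𝕜 F lam) (x : ℝ) :
    AnalyticAt 𝕜 (fun z => F z x) lam :=
  AnalyticAt.comp (g := BoundedContinuousFunction.evalCLM 𝕜 x) (f := F)
    (ContinuousLinearMap.analyticAt _ _) hF

end

end SturmLiouville

namespace SturmLiouville

open BoundedContinuousFunction

variable {𝕜 : Type*} [RCLike 𝕜]

lemma absolutelyContinuousOnInterval_integral {E : Type*} [NormedAddCommGroup E]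
    [NormedSpace ℝ E] {f : ℝ → E} {a b : ℝ}
    (hf : IntervalIntegrable f volume a b) :
    AbsolutelyContinuousOnInterval (fun x => ∫ t in a..x, f t) a b := by
  have h := hf.norm.absolutelyContinuousOnInterval_intervalIntegral left_mem_uIcc
  rw [absolutelyContinuousOnInterval_iff] at h ⊢
  intro ε hε
  obtain ⟨δ, hδ, H⟩ := h ε hε
  refine ⟨δ, hδ, fun E hE hlt => (Finset.sum_le_sum fun i hi => ?_).trans_lt (H E hE hlt)⟩
  obtain ⟨hx, hy⟩ := hE.1 i hi
  have key : ∀ z ∈ uIcc a b, IntervalIntegrable f volume a z := fun z hz =>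
    hf.mono_set (uIcc_subset_uIcc left_mem_uIcc hz)
  rw [dist_eq_norm, Real.dist_eq, intervalIntegral.integral_interval_sub_left (key _ hx) (key _ hy),
    intervalIntegral.integral_interval_sub_left (key _ hx).norm (key _ hy).norm]
  exact intervalIntegral.norm_integral_le_abs_integral_norm

/-- The product rule for primitives of integrable functions. -/
lemma mul_eq_add_integral {g g' h h' : ℝ → 𝕜}
    (hg' : IntervalIntegrable g' volume 0 Real.pi) (hh' : IntervalIntegrable h' volume 0 Real.pi)
    (hg : ∀ x ∈ Icc (0 : ℝ) Real.pi, g x = g 0 + ∫ t in (0 : ℝ)..x, g' t)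
    (hh : ∀ x ∈ Icc (0 : ℝ) Real.pi, h x = h 0 + ∫ t in (0 : ℝ)..x, h' t)
    {x : ℝ} (hx : x ∈ Icc (0 : ℝ) Real.pi) :
    g x * h x = g 0 * h 0 + ∫ t in (0 : ℝ)..x, (g' t * h t + g t * h' t) := by
  have hI : uIcc 0 Real.pi = Icc 0 Real.pi := uIcc_of_le Real.pi_pos.le
  set G : ℝ → 𝕜 := fun x => g 0 + ∫ t in (0 : ℝ)..x, g' t
  set H : ℝ → 𝕜 := fun x => h 0 + ∫ t in (0 : ℝ)..x, h' t
  have acc : ∀ c : 𝕜, AbsolutelyContinuousOnInterval (fun _ : ℝ => c) 0 Real.pi := fun c =>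
    (LipschitzOnWith.of_dist_le_mul (K := 0) fun _ _ _ _ => by simp).absolutelyContinuousOnInterval
  have acG : AbsolutelyContinuousOnInterval G 0 Real.pi :=
    (acc _).add (absolutelyContinuousOnInterval_integral hg')
  have acH : AbsolutelyContinuousOnInterval H 0 Real.pi :=
    (acc _).add (absolutelyContinuousOnInterval_integral hh')
  have hint : IntervalIntegrable (fun t => g' t * H t + G t * h' t) volume 0 Real.pi :=
    (hg'.mul_continuousOn acH.continuousOn).add (hh'.continuousOn_mul acG.continuousOn)
  set F : ℝ → 𝕜 := fun x => G x * H x - ∫ t in (0 : ℝ)..x, (g' t * H t + G t * h' t)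
  have acF : AbsolutelyContinuousOnInterval F 0 Real.pi :=
    (acG.smul acH).sub (absolutelyContinuousOnInterval_integral hint)
  have hF : ∀ᵐ x, x ∈ uIcc 0 Real.pi → HasDerivAt F 0 x := by
    filter_upwards [hg'.ae_hasDerivAt_integral, hh'.ae_hasDerivAt_integral,
      hint.ae_hasDerivAt_integral] with x h1 h2 h3 hx
    have d1 : HasDerivAt G (g' x) x := (h1 hx 0 left_mem_uIcc).const_add _
    have d2 : HasDerivAt H (h' x) x := (h2 hx 0 left_mem_uIcc).const_add _
    have := (d1.mul d2).sub (h3 hx 0 left_mem_uIcc)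
    rw [sub_self] at this
    exact this
  obtain ⟨C, hC⟩ := acF.const_of_ae_hasDerivAt_zero hF
  have e0 := hC 0 left_mem_uIcc
  have ex := hC x (by rwa [hI])
  have hcongr : ∫ t in (0 : ℝ)..x, (g' t * H t + G t * h' t) =
      ∫ t in (0 : ℝ)..x, (g' t * h t + g t * h' t) := by
    refine intervalIntegral.integral_congr fun t ht => ?_
    rw [uIcc_of_le hx.1] at ht
    have ht' : t ∈ Icc 0 Real.pi := ⟨ht.1, ht.2.trans hx.2⟩
    simp only [G, H, ← hg t ht', ← hh t ht']
  simp only [F, hcongr] at e0 ex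
  simp only [intervalIntegral.integral_same, sub_zero] at e0
  have hG0 : G 0 = g 0 := by simp [G]
  have hH0 : H 0 = h 0 := by simp [H]
  have hGx : G x = g x := (hg x hx).symm
  have hHx : H x = h x := (hh x hx).symm
  rw [hG0, hH0] at e0
  rw [hGx, hHx, ← e0] at ex
  linear_combination ex

lemma IsSol.intervalIntegrable_deriv {q : ℝ → ℝ} {lam : 𝕜} {y y' : ℝ → 𝕜}
    (h : IsSol q lam y y') : IntervalIntegrable y' volume 0 Real.pi :=
  (h.2.1.mono (uIcc_of_le Real.pi_pos.le).le).intervalIntegrable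

lemma IsSol.intervalIntegrable_pot_mul {q : ℝ → ℝ} (hq : IntervalIntegrable q volume 0 Real.pi)
    {lam : 𝕜} {y y' : ℝ → 𝕜} (h : IsSol q lam y y') :
    IntervalIntegrable (fun t => ((q t : 𝕜) - lam) * y t) volume 0 Real.pi :=
  (intervalIntegrable_pot hq lam).mul_continuousOn (h.1.mono (uIcc_of_le Real.pi_pos.le).le)

/-- Green's formula. -/
lemma IsSol.green {q p : ℝ → ℝ} (hq : IntervalIntegrable q volume 0 Real.pi)
    (hp : IntervalIntegrable p volume 0 Real.pi) {lam mu : 𝕜} {y y' w w' : ℝ → 𝕜}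
    (hy : IsSol q lam y y') (hw : IsSol p mu w w') {x : ℝ} (hx : x ∈ Icc (0 : ℝ) Real.pi) :
    y' x * w x - y x * w' x = y' 0 * w 0 - y 0 * w' 0 +
      ∫ t in (0 : ℝ)..x, (((q t : 𝕜) - lam) - ((p t : 𝕜) - mu)) * (y t * w t) := by
  have e1 := mul_eq_add_integral (hy.intervalIntegrable_pot_mul hq) hw.intervalIntegrable_deriv
    hy.2.2.2 hw.2.2.1 hx
  have e2 := mul_eq_add_integral hy.intervalIntegrable_deriv (hw.intervalIntegrable_pot_mul hp)
    hy.2.2.1 hw.2.2.2 hx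
  have hI : uIcc 0 x ⊆ Icc 0 Real.pi := by
    rw [uIcc_of_le hx.1]; exact Icc_subset_Icc_right hx.2
  have i1 := (intervalIntegrable_sub (hy.intervalIntegrable_pot_mul hq) hx).mul_continuousOn
    (hw.1.mono hI)
  have i2 := (intervalIntegrable_sub (hw.intervalIntegrable_pot_mul hp) hx).continuousOn_mul
    (hy.1.mono hI)
  have i3 : IntervalIntegrable (fun t => y' t * w' t) volume 0 x :=
    ((hy.2.1.mono hI).mul (hw.2.1.mono hI)).intervalIntegrable
  rw [intervalIntegral.integral_add i1 i3] at e1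
  rw [intervalIntegral.integral_add i3 i2] at e2
  have : ∫ t in (0 : ℝ)..x, (((q t : 𝕜) - lam) - ((p t : 𝕜) - mu)) * (y t * w t) =
      (∫ t in (0 : ℝ)..x, ((q t : 𝕜) - lam) * y t * w t) -
        ∫ t in (0 : ℝ)..x, y t * (((p t : 𝕜) - mu) * w t) := by
    rw [← intervalIntegral.integral_sub i1 i2]
    congr 1
    ext t
    ring
  rw [this]
  linear_combination e1 - e2

lemma IsSol.wronskian {q : ℝ → ℝ} (hq : IntervalIntegrable q volume 0 Real.pi)
    {lam : 𝕜} {y y' w w' : ℝ → 𝕜}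
    (hy : IsSol q lam y y') (hw : IsSol q lam w w') {x : ℝ} (hx : x ∈ Icc (0 : ℝ) Real.pi) :
    y' x * w x - y x * w' x = y' 0 * w 0 - y 0 * w' 0 := by
  rw [hy.green hq hq hw hx]
  simp

lemma intervalIntegrable_reflect {q : ℝ → ℝ} (hq : IntervalIntegrable q volume 0 Real.pi) :
    IntervalIntegrable (fun s => q (Real.pi - s)) volume 0 Real.pi := by
  have := hq.comp_sub_left Real.pi
  simp only [sub_zero, sub_self] at this
  exact this.symm

/-- Reflecting the interval `[0, π]` maps solutions to solutions. -/
lemma IsSol.reflect {q : ℝ → ℝ} (hq : IntervalIntegrable q volume 0 Real.pi)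
    {lam : 𝕜} {y y' : ℝ → 𝕜} (hy : IsSol q lam y y') :
    IsSol (fun s => q (Real.pi - s)) lam (fun s => y (Real.pi - s))
      (fun s => -y' (Real.pi - s)) := by
  have hm : MapsTo (fun s => Real.pi - s) (Icc 0 Real.pi) (Icc 0 Real.pi) := fun s hs =>
    ⟨by linarith [hs.2], by linarith [hs.1]⟩
  have hpi : Real.pi ∈ Icc (0 : ℝ) Real.pi := ⟨Real.pi_pos.le, le_rfl⟩
  have hc : ContinuousOn (fun s : ℝ => Real.pi - s) (Icc 0 Real.pi) := by fun_prop
  refine ⟨hy.1.comp hc hm, (hy.2.1.comp hc hm).neg, fun x hx => ?_, fun x hx => ?_⟩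
  · have i1 := intervalIntegrable_sub hy.intervalIntegrable_deriv hpi
    have i2 := intervalIntegrable_sub hy.intervalIntegrable_deriv (hm hx)
    rw [intervalIntegral.integral_neg, intervalIntegral.integral_comp_sub_left (fun t => y' t),
      sub_zero, ← intervalIntegral.integral_interval_sub_left i1 i2]
    have e1 := hy.2.2.1 _ hpi
    have e2 := hy.2.2.1 _ (hm hx)
    simp only [sub_zero] at e2 ⊢
    linear_combination e2 - e1
  · have i1 := intervalIntegrable_sub (hy.intervalIntegrable_pot_mul hq) hpi
    have i2 := intervalIntegrable_sub (hy.intervalIntegrable_pot_mul hq) (hm hx)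
    rw [intervalIntegral.integral_comp_sub_left (fun t => ((q t : 𝕜) - lam) * y t),
      sub_zero, ← intervalIntegral.integral_interval_sub_left i1 i2]
    have e1 := hy.2.2.2 _ hpi
    have e2 := hy.2.2.2 _ (hm hx)
    simp only [sub_zero] at e2 ⊢
    linear_combination e1 - e2

end SturmLiouville

namespace RatHN

variable (f : RatHN)

/-- The denominator `∏ (β_j - λ)` of `f`. -/
def den (lam : ℝ) : ℝ := ∏ i, (f.β i - lam)

/-- The product of all factors of the denominator but one. -/
def denErase (j : Fin f.n) (lam : ℝ) : ℝ := ∏ i ∈ Finset.univ.erase j, (f.β i - lam)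

/-- The numerator of `f` over the denominator `den`. -/
def num (lam : ℝ) : ℝ := (f.a * lam + f.c) * f.den lam + ∑ j, f.γ j * f.denErase j lam

lemma den_eq_mul (j : Fin f.n) (lam : ℝ) : f.den lam = (f.β j - lam) * f.denErase j lam :=
  (Finset.mul_prod_erase _ _ (Finset.mem_univ j)).symm

lemma den_eq_zero_iff (lam : ℝ) : f.den lam = 0 ↔ f.IsPole lam := by
  simp [den, IsPole, Finset.prod_eq_zero_iff, sub_eq_zero]

lemma denErase_β_ne_zero (j : Fin f.n) : f.denErase j (f.β j) ≠ 0 := by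
  refine Finset.prod_ne_zero_iff.2 fun i hi => ?_
  rw [sub_ne_zero]
  exact fun h => (Finset.ne_of_mem_erase hi) (f.hβ.injective h)

lemma num_β (j : Fin f.n) : f.num (f.β j) = f.γ j * f.denErase j (f.β j) := by
  have h : f.den (f.β j) = 0 := (f.den_eq_zero_iff _).2 ⟨j, rfl⟩
  rw [num, h, mul_zero, zero_add]
  refine Finset.sum_eq_single j (fun i _ hij => ?_) (by simp)
  have : f.denErase i (f.β j) = 0 :=
    Finset.prod_eq_zero (Finset.mem_erase.2 ⟨hij.symm, Finset.mem_univ j⟩) (sub_self _)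
  rw [this, mul_zero]

lemma num_ne_zero_of_isPole {lam : ℝ} (h : f.IsPole lam) : f.num lam ≠ 0 := by
  obtain ⟨j, rfl⟩ := h
  rw [num_β]
  exact mul_ne_zero (f.hγ j).ne' (f.denErase_β_ne_zero j)

lemma num_eq_eval_mul {lam : ℝ} (h : ¬ f.IsPole lam) : f.num lam = f.eval lam * f.den lam := by
  have hs : (∑ j, f.γ j / (f.β j - lam)) * f.den lam = ∑ j, f.γ j * f.denErase j lam := by
    rw [Finset.sum_mul]
    refine Finset.sum_congr rfl fun j _ => ?_
    have hj : f.β j - lam ≠ 0 := sub_ne_zero.2 fun e => h ⟨j, e⟩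
    rw [den_eq_mul f j]
    field_simp
  rw [num, eval]
  linear_combination -hs

lemma den_ne_zero_or_num_ne_zero (lam : ℝ) : f.den lam ≠ 0 ∨ f.num lam ≠ 0 := by
  by_cases h : f.IsPole lam
  · exact Or.inr (f.num_ne_zero_of_isPole h)
  · exact Or.inl fun e => h ((f.den_eq_zero_iff lam).1 e)

lemma analyticAt_den (lam : ℝ) : AnalyticAt ℝ f.den lam := by
  unfold den
  exact Finset.analyticAt_fun_prod _ fun i _ => analyticAt_const.sub analyticAt_id

lemma analyticAt_denErase (j : Fin f.n) (lam : ℝ) : AnalyticAt ℝ (f.denErase j) lam := by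
  unfold denErase
  exact Finset.analyticAt_fun_prod _ fun i _ => analyticAt_const.sub analyticAt_id

lemma analyticAt_num (lam : ℝ) : AnalyticAt ℝ f.num lam := by
  unfold num
  exact (((analyticAt_const.mul analyticAt_id).add analyticAt_const).mul
    (f.analyticAt_den lam)).add (Finset.analyticAt_fun_sum _ fun i _ =>
      analyticAt_const.mul (f.analyticAt_denErase i lam))

lemma continuous_den : Continuous f.den :=
  continuous_iff_continuousAt.2 fun x => (f.analyticAt_den x).continuousAt

lemma continuous_denErase (j : Fin f.n) : Continuous (f.denErase j) :=
  continuous_iff_continuousAt.2 fun x => (f.analyticAt_denErase j x).continuousAt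

/-- The Bezoutian of numerator and denominator, which is the positive kernel of `f` up to the
factors `den`. -/
def kernel (lam mu : ℝ) : ℝ :=
  f.a * f.den lam * f.den mu + ∑ j, f.γ j * (f.denErase j lam * f.denErase j mu)

lemma den_mul_num_sub (lam mu : ℝ) :
    f.den mu * f.num lam - f.num mu * f.den lam = (lam - mu) * f.kernel lam mu := by
  have : ∀ j, f.den mu * (f.γ j * f.denErase j lam) - f.γ j * f.denErase j mu * f.den lam =
      (lam - mu) * (f.γ j * (f.denErase j lam * f.denErase j mu)) := fun j => by
    rw [f.den_eq_mul j lam, f.den_eq_mul j mu]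
    ring
  have hs : f.den mu * ∑ j, f.γ j * f.denErase j lam -
      (∑ j, f.γ j * f.denErase j mu) * f.den lam =
      (lam - mu) * ∑ j, f.γ j * (f.denErase j lam * f.denErase j mu) := by
    rw [Finset.mul_sum, Finset.sum_mul, Finset.mul_sum, ← Finset.sum_sub_distrib]
    exact Finset.sum_congr rfl fun j _ => this j
  rw [num, num, kernel]
  linear_combination hs

lemma kernel_self_nonneg (lam : ℝ) : 0 ≤ f.kernel lam lam := by
  have h : 0 ≤ f.a * f.den lam * f.den lam := by
    rw [mul_assoc]; exact mul_nonneg f.ha (mul_self_nonneg _)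
  exact add_nonneg h (Finset.sum_nonneg fun j _ =>
    mul_nonneg (f.hγ j).le (mul_self_nonneg _))

lemma continuous_kernel (lam : ℝ) : Continuous (f.kernel lam) := by
  have := f.continuous_den
  have := f.continuous_denErase
  unfold kernel
  fun_prop

end RatHN

namespace SturmLiouville

open BoundedContinuousFunction

variable {𝕜 : Type*} [RCLike 𝕜]

lemma pi_mem : Real.pi ∈ Icc (0 : ℝ) Real.pi := ⟨Real.pi_pos.le, le_rfl⟩

lemma zero_mem : (0 : ℝ) ∈ Icc (0 : ℝ) Real.pi := ⟨le_rfl, Real.pi_pos.le⟩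

lemma IsSol.initial_eq_zero {q : ℝ → ℝ} {lam : 𝕜} {y y' : ℝ → 𝕜} (h : IsSol q lam y y')
    (h0 : ∀ x ∈ Icc (0 : ℝ) Real.pi, y x = 0) : y 0 = 0 ∧ y' 0 = 0 := by
  have hy' : ∀ x ∈ Icc (0 : ℝ) Real.pi, y' x = y' 0 := by
    intro x hx
    rw [h.2.2.2 x hx, add_eq_left]
    refine intervalIntegral.integral_zero_ae (Filter.Eventually.of_forall fun t ht => ?_)
    rw [uIoc_of_le hx.1] at ht
    rw [h0 t ⟨ht.1.le, ht.2.trans hx.2⟩, mul_zero]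
  have hpi := h.2.2.1 _ pi_mem
  have hc : ∫ t in (0 : ℝ)..Real.pi, y' t = ∫ t in (0 : ℝ)..Real.pi, y' 0 := by
    refine intervalIntegral.integral_congr fun t ht => ?_
    rw [uIcc_of_le Real.pi_pos.le] at ht
    exact hy' t ht
  rw [hc, h0 _ pi_mem, h0 _ zero_mem, intervalIntegral.integral_const, zero_add, sub_zero] at hpi
  exact ⟨h0 _ zero_mem, (smul_eq_zero.1 hpi.symm).resolve_left Real.pi_pos.ne'⟩

section Real

variable {q : ℝ → ℝ} (hq : IntervalIntegrable q volume 0 Real.pi) (f : RatHN)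

/-- The value at `π` of the solution satisfying the left boundary condition. -/
def endVal (lam : ℝ) : ℝ := sol hq lam (f.den lam) (-f.num lam) Real.pi

/-- The derivative at `π` of the solution satisfying the left boundary condition. -/
def endDer (lam : ℝ) : ℝ := dsol hq lam (f.den lam) (-f.num lam) Real.pi

lemma isEigen_iff (b lam : ℝ) :
    IsEigen q f (some b) lam ↔ endDer hq f lam = b * endVal hq f lam := by
  constructor
  · rintro ⟨y, y', hy, ⟨x, hx, hne⟩, h1, h2, h3, -⟩
    rw [isCaraSol_iff_isSol] at hy
    obtain ⟨t, ht0, ht1⟩ : ∃ t : ℝ, y 0 = t * f.den lam ∧ y' 0 = t * -f.num lam := by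
      by_cases hp : f.IsPole lam
      · have hn := f.num_ne_zero_of_isPole hp
        refine ⟨-y' 0 / f.num lam, ?_, by field_simp⟩
        rw [h2 hp, (f.den_eq_zero_iff lam).2 hp, mul_zero]
      · have hd : f.den lam ≠ 0 := fun e => hp ((f.den_eq_zero_iff lam).1 e)
        refine ⟨y 0 / f.den lam, by field_simp, ?_⟩
        rw [h1 hp, f.num_eq_eval_mul hp]
        field_simp
    have hs : sol hq lam (y 0) (y' 0) = t • sol hq lam (f.den lam) (-f.num lam) := by
      rw [sol_linear, sol_linear hq lam (f.den lam), ht0, ht1, smul_add, smul_smul, smul_smul]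
    have hs' : dsol hq lam (y 0) (y' 0) = t • dsol hq lam (f.den lam) (-f.num lam) := by
      rw [dsol_linear, dsol_linear hq lam (f.den lam), ht0, ht1, smul_add, smul_smul, smul_smul]
    have ht : t ≠ 0 := by
      rintro rfl
      apply hne
      rw [(hy.eq_sol hq hx).1, hs]
      simp
    have := h3 b rfl
    rw [(hy.eq_sol hq pi_mem).1, (hy.eq_sol hq pi_mem).2, hs, hs'] at this
    simp only [BoundedContinuousFunction.smul_apply, smul_eq_mul] at this
    refine mul_left_cancel₀ ht ?_
    rw [endDer, endVal, this]
    ring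
  · intro h
    refine ⟨sol hq lam (f.den lam) (-f.num lam), dsol hq lam (f.den lam) (-f.num lam),
      isCaraSol_iff_isSol.2 (isSol_sol hq _ _ _), ?_, ?_, ?_, ?_, by simp⟩
    · by_contra! h0
      have := (isSol_sol hq lam (f.den lam) (-f.num lam)).initial_eq_zero h0
      rw [sol_zero, dsol_zero, neg_eq_zero] at this
      exact (f.den_ne_zero_or_num_ne_zero lam).elim (fun e => e this.1) (fun e => e this.2)
    · intro hp
      rw [sol_zero, dsol_zero, f.num_eq_eval_mul hp]
      ring
    · intro hp
      rw [sol_zero, (f.den_eq_zero_iff lam).2 hp]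
    · rintro bb hb
      obtain rfl := Option.some.inj hb
      exact h

lemma analyticAt_sol_data {a b : ℝ → ℝ} {lam : ℝ} (ha : AnalyticAt ℝ a lam)
    (hb : AnalyticAt ℝ b lam) : AnalyticAt ℝ (fun z => sol hq z (a z) (b z)) lam := by
  have h : (fun z => sol hq z (a z) (b z)) =
      fun z => a z • sol hq z 1 0 + b z • sol hq z 0 1 := funext fun z => sol_linear hq _ _ _
  rw [h]
  exact (ha.smul (analyticAt_sol hq 1 0 lam)).add (hb.smul (analyticAt_sol hq 0 1 lam))

lemma analyticAt_dsol_data {a b : ℝ → ℝ} {lam : ℝ} (ha : AnalyticAt ℝ a lam)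
    (hb : AnalyticAt ℝ b lam) : AnalyticAt ℝ (fun z => dsol hq z (a z) (b z)) lam := by
  have h : (fun z => dsol hq z (a z) (b z)) =
      fun z => a z • dsol hq z 1 0 + b z • dsol hq z 0 1 := funext fun z => dsol_linear hq _ _ _
  rw [h]
  exact (ha.smul (analyticAt_dsol hq 1 0 lam)).add (hb.smul (analyticAt_dsol hq 0 1 lam))

lemma analyticAt_endVal (lam : ℝ) : AnalyticAt ℝ (endVal hq f) lam :=
  analyticAt_eval (analyticAt_sol_data hq (f.analyticAt_den lam) (f.analyticAt_num lam).neg) _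

lemma analyticAt_endDer (lam : ℝ) : AnalyticAt ℝ (endDer hq f) lam :=
  analyticAt_eval (analyticAt_dsol_data hq (f.analyticAt_den lam) (f.analyticAt_num lam).neg) _

/-- The quotient `y'(π)/y(π)` is strictly decreasing in the spectral parameter. -/
lemma deriv_wronskian_neg (lam : ℝ) :
    deriv (endDer hq f) lam * endVal hq f lam - deriv (endVal hq f) lam * endDer hq f lam < 0 := by
  set Y : ℝ → (ℝ →ᵇ ℝ) := fun mu => sol hq mu (f.den mu) (-f.num mu)
  set H : ℝ → ℝ := fun mu => f.kernel lam mu + primOne ℝ (Y mu * Y lam) Real.pi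
  have hH : ContinuousAt H lam := by
    have h1 : ContinuousAt Y lam :=
      (analyticAt_sol_data hq (f.analyticAt_den lam) (f.analyticAt_num lam).neg).continuousAt
    have h2 : ContinuousAt (fun mu => primOne ℝ (Y mu * Y lam)) lam :=
      (primOne ℝ).continuous.continuousAt.comp (h1.mul continuousAt_const)
    have h3 : ContinuousAt (fun mu => primOne ℝ (Y mu * Y lam) Real.pi) lam :=
      (BoundedContinuousFunction.evalCLM ℝ Real.pi).continuous.continuousAt.comp h2
    exact (f.continuous_kernel lam).continuousAt.add h3
  have hprim : ∀ mu, primOne ℝ (Y mu * Y lam) Real.pi =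
      ∫ t in (0 : ℝ)..Real.pi, Y mu t * Y lam t := by
    intro mu
    rw [prim_apply, clamp_of_mem pi_mem]
    simp
  have hW : ∀ mu, endDer hq f mu * endVal hq f lam - endVal hq f mu * endDer hq f lam =
      (lam - mu) * H mu := by
    intro mu
    have := (isSol_sol hq mu (f.den mu) (-f.num mu)).green hq hq
      (isSol_sol hq lam (f.den lam) (-f.num lam)) pi_mem
    simp only [sol_zero, dsol_zero] at this
    rw [endDer, endVal, endVal, endDer, this]
    simp only [H, hprim]
    rw [mul_add, ← f.den_mul_num_sub, ← intervalIntegral.integral_const_mul]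
    have e : ∀ t, (((q t : ℝ) - mu) - (q t - lam)) * (Y mu t * Y lam t) =
        (lam - mu) * (Y mu t * Y lam t) := fun t => by ring
    simp only [RCLike.ofReal_real_eq_id, id, Y] at e ⊢
    simp only [e]
    ring
  have hpos : 0 < H lam := by
    refine add_pos_of_nonneg_of_pos (f.kernel_self_nonneg lam) ?_
    rw [hprim]
    refine intervalIntegral.integral_pos Real.pi_pos
      ((Y lam).continuous.mul (Y lam).continuous).continuousOn
      (fun x _ => mul_self_nonneg _) ?_
    by_contra! h0
    have h1 : ∀ x ∈ Icc (0 : ℝ) Real.pi, Y lam x = 0 := fun x hx =>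
      mul_self_eq_zero.1 (le_antisymm (h0 x hx) (mul_self_nonneg _))
    have := (isSol_sol hq lam (f.den lam) (-f.num lam)).initial_eq_zero h1
    rw [sol_zero, dsol_zero, neg_eq_zero] at this
    exact (f.den_ne_zero_or_num_ne_zero lam).elim (fun e => e this.1) (fun e => e this.2)
  have hd1 : HasDerivAt (fun mu => (lam - mu) * H mu) (-H lam) lam := by
    rw [hasDerivAt_iff_tendsto_slope]
    refine (hH.neg.tendsto.mono_left nhdsWithin_le_nhds).congr' ?_
    filter_upwards [self_mem_nhdsWithin] with mu hmu
    have : mu - lam ≠ 0 := sub_ne_zero.2 hmu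
    simp only [Pi.neg_apply, slope, vsub_eq_sub, smul_eq_mul, sub_self, zero_mul, sub_zero]
    field_simp
    ring
  have hd2 := ((analyticAt_endDer hq f lam).differentiableAt.hasDerivAt.mul_const
    (endVal hq f lam)).sub ((analyticAt_endVal hq f lam).differentiableAt.hasDerivAt.mul_const
    (endDer hq f lam))
  have hd3 := hd2.congr_of_eventuallyEq (Filter.Eventually.of_forall fun mu => (hW mu).symm)
  have := hd1.unique hd3
  linarith

end Real

/-- Strictly between two eigenvalues of one problem there is an eigenvalue of the other. -/
lemma exists_eigen_between {q : ℝ → ℝ} (hq : IntervalIntegrable q volume 0 Real.pi) (f : RatHN)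
    {b b' : ℝ} (hb : b ≠ b') {x y : ℝ} (hxy : x < y)
    (hx : IsEigen q f (some b) x) (hy : IsEigen q f (some b) y) :
    ∃ z ∈ Ioo x y, IsEigen q f (some b') z := by
  rw [isEigen_iff hq] at hx hy
  simp only [isEigen_iff hq]
  set U := endVal hq f
  set V := endDer hq f
  by_contra! hne
  have hend : ∀ z, V z = b * U z → V z ≠ b' * U z := by
    intro z h1 h2
    have hU : U z = 0 := by
      have : (b - b') * U z = 0 := by linear_combination h2 - h1
      exact (mul_eq_zero.1 this).resolve_left (sub_ne_zero.2 hb)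
    have hV : V z = 0 := by rw [h1, hU, mul_zero]
    have := deriv_wronskian_neg hq f z
    change deriv V z * U z - deriv U z * V z < 0 at this
    simp [hU, hV] at this
  have hne' : ∀ z ∈ Icc x y, V z - b' * U z ≠ 0 := by
    intro z hz
    rw [sub_ne_zero]
    rcases eq_or_lt_of_le hz.1 with rfl | h1
    · exact hend _ hx
    rcases eq_or_lt_of_le hz.2 with rfl | h2
    · exact hend _ hy
    exact hne z ⟨h1, h2⟩
  have hdU : ∀ z, HasDerivAt U (deriv U z) z := fun z =>
    (analyticAt_endVal hq f z).differentiableAt.hasDerivAt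
  have hdV : ∀ z, HasDerivAt V (deriv V z) z := fun z =>
    (analyticAt_endDer hq f z).differentiableAt.hasDerivAt
  have hdg : ∀ z ∈ Icc x y, HasDerivAt (fun z => (V z - b * U z) / (V z - b' * U z))
      (((deriv V z - b * deriv U z) * (V z - b' * U z) -
        (V z - b * U z) * (deriv V z - b' * deriv U z)) / (V z - b' * U z) ^ 2) z := fun z hz =>
    ((hdV z).sub ((hdU z).const_mul b)).div ((hdV z).sub ((hdU z).const_mul b')) (hne' z hz)
  obtain ⟨c, hc, hc0⟩ := exists_hasDerivAt_eq_zero hxy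
    (fun z hz => (hdg z hz).continuousAt.continuousWithinAt)
    (by rw [hx, hy]; simp) (fun z hz => hdg z (Ioo_subset_Icc_self hz))
  rw [div_eq_zero_iff] at hc0
  have h1 := hc0.resolve_right (pow_ne_zero 2 (hne' c (Ioo_subset_Icc_self hc)))
  have h2 : (b - b') * (deriv V c * U c - deriv U c * V c) = 0 := by linear_combination h1
  have h3 := (mul_eq_zero.1 h2).resolve_left (sub_ne_zero.2 hb)
  exact (deriv_wronskian_neg hq f c).ne h3

/-- If between any two points of `S` there is a point of `T`, then the enumeration of `T` is
controlled by that of `S`. -/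
lemma isEnum_le_succ {S T : Set ℝ} {Λ M : ℕ → ℝ} (hΛ : IsEnum S Λ) (hM : IsEnum T M)
    (h : ∀ x ∈ S, ∀ y ∈ S, x < y → ∃ z ∈ Ioo x y, z ∈ T) (k : ℕ) : M k ≤ Λ (k + 1) := by
  have hmem : ∀ i, Λ i ∈ S := fun i => hΛ.2 ▸ mem_range_self i
  choose z hz hzT using fun i => h _ (hmem i) _ (hmem (i + 1)) (hΛ.1 i.lt_succ_self)
  choose n hn using fun i => (hM.2.symm ▸ hzT i : z i ∈ range M)
  have hnm : StrictMono n := strictMono_nat_of_lt_succ fun i => by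
    rw [← hM.1.lt_iff_lt, hn, hn]
    exact (hz i).2.trans (hz (i + 1)).1
  calc M k ≤ M (n k) := hM.1.monotone (hnm.le_apply)
    _ = z k := hn k
    _ ≤ Λ (k + 1) := (hz k).2.le

lemma isEnum_zero_le {S T : Set ℝ} {Λ M : ℕ → ℝ} (hΛ : IsEnum S Λ) (hM : IsEnum T M)
    (h : ∀ x ∈ T, ∀ y ∈ T, x < y → ∃ z ∈ Ioo x y, z ∈ S) {k : ℕ} (hk : 1 ≤ k) :
    Λ 0 ≤ M k := by
  have hmem : ∀ i, M i ∈ T := fun i => hM.2 ▸ mem_range_self i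
  obtain ⟨z, hz, hzS⟩ := h _ (hmem 0) _ (hmem 1) (hM.1 zero_lt_one)
  obtain ⟨n, rfl⟩ := hΛ.2.symm ▸ hzS
  exact ((hΛ.1.monotone n.zero_le).trans hz.2.le).trans (hM.1.monotone hk)

/-- Coincidence of the `k`-th eigenvalues for infinitely many boundary conditions forces the Weyl
functions to coincide. -/
theorem weyl_eq {q₁ q₂ : ℝ → ℝ} (hq₁ : IntervalIntegrable q₁ volume 0 Real.pi)
    (hq₂ : IntervalIntegrable q₂ volume 0 Real.pi) (f₁ f₂ : RatHN) {k : ℕ} (hk : 1 ≤ k)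
    {b : ℕ → ℝ} (hb : Function.Injective b)
    (h : ∀ j : ℕ, ∃ Λ₁ Λ₂ : ℕ → ℝ,
      IsEnum (eigenvalues q₁ f₁ (some (b j))) Λ₁ ∧
      IsEnum (eigenvalues q₂ f₂ (some (b j))) Λ₂ ∧ Λ₁ k = Λ₂ k) (lam : ℝ) :
    endDer hq₁ f₁ lam * endVal hq₂ f₂ lam = endVal hq₁ f₁ lam * endDer hq₂ f₂ lam := by
  choose Λ₁ Λ₂ h₁ h₂ he using h
  have hmem₁ : ∀ j, endDer hq₁ f₁ (Λ₁ j k) = b j * endVal hq₁ f₁ (Λ₁ j k) := fun j =>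
    (isEigen_iff hq₁ f₁ _ _).1 ((h₁ j).2.subset (mem_range_self k))
  have hmem₂ : ∀ j, endDer hq₂ f₂ (Λ₁ j k) = b j * endVal hq₂ f₂ (Λ₁ j k) := fun j =>
    (isEigen_iff hq₂ f₂ _ _).1 (he j ▸ (h₂ j).2.subset (mem_range_self k))
  have hinj : Function.Injective fun j => Λ₁ j k := by
    intro i j hij
    have hi := hmem₁ i
    have hj := hmem₁ j
    simp only at hij
    rw [← hij] at hj
    by_contra hne
    have hU : endVal hq₁ f₁ (Λ₁ i k) = 0 := by
      have : (b i - b j) * endVal hq₁ f₁ (Λ₁ i k) = 0 := by linear_combination hj - hi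
      exact (mul_eq_zero.1 this).resolve_left (sub_ne_zero.2 (hb.ne hne))
    have hV : endDer hq₁ f₁ (Λ₁ i k) = 0 := by rw [hi, hU, mul_zero]
    have := deriv_wronskian_neg hq₁ f₁ (Λ₁ i k)
    simp [hU, hV] at this
  have hbetween : ∀ i j, i ≠ j → ∀ x ∈ eigenvalues q₁ f₁ (some (b i)),
      ∀ y ∈ eigenvalues q₁ f₁ (some (b i)), x < y →
        ∃ z ∈ Ioo x y, z ∈ eigenvalues q₁ f₁ (some (b j)) := fun i j hij x hx y hy hxy =>
    exists_eigen_between hq₁ f₁ (hb.ne hij) hxy hx hy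
  have hbdd : (fun j => Λ₁ j k) '' {0}ᶜ ⊆ Icc (Λ₁ 0 0) (Λ₁ 0 (k + 1)) := by
    rintro _ ⟨j, hj, rfl⟩
    exact ⟨isEnum_zero_le (h₁ 0) (h₁ j) (hbetween j 0 hj) hk,
      isEnum_le_succ (h₁ 0) (h₁ j) (hbetween 0 j (Ne.symm hj)) k⟩
  have hinf : ((fun j => Λ₁ j k) '' {0}ᶜ).Infinite :=
    (Set.finite_singleton 0).infinite_compl.image hinj.injOn
  obtain ⟨x₀, -, hacc⟩ := hinf.exists_accPt_of_subset_isCompact isCompact_Icc hbdd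
  set D : ℝ → ℝ := fun x =>
    endDer hq₁ f₁ x * endVal hq₂ f₂ x - endVal hq₁ f₁ x * endDer hq₂ f₂ x
  have hD : AnalyticOnNhd ℝ D univ := fun x _ =>
    ((analyticAt_endDer hq₁ f₁ x).mul (analyticAt_endVal hq₂ f₂ x)).sub
      ((analyticAt_endVal hq₁ f₁ x).mul (analyticAt_endDer hq₂ f₂ x))
  have hfreq : ∃ᶠ x in nhdsWithin x₀ {x₀}ᶜ, D x = 0 := by
    rw [accPt_iff_frequently_nhdsNE] at hacc
    refine hacc.mono ?_
    rintro _ ⟨j, -, rfl⟩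
    simp only [D]
    rw [hmem₁, hmem₂]
    ring
  have := hD.eqOn_zero_of_preconnected_of_frequently_eq_zero isPreconnected_univ (mem_univ x₀)
    hfreq (mem_univ lam)
  exact sub_eq_zero.1 this

end SturmLiouville

namespace SturmLiouville

open BoundedContinuousFunction

variable {𝕜 : Type*} [RCLike 𝕜]

/-- The `L¹` norm of the potential. -/
def potNorm (q : ℝ → ℝ) : ℝ := ∫ t in (0 : ℝ)..Real.pi, |q t|

lemma potNorm_nonneg (q : ℝ → ℝ) : 0 ≤ potNorm q :=
  intervalIntegral.integral_nonneg Real.pi_pos.le fun _ _ => abs_nonneg _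

lemma isSol_zero_of_hasDerivAt {lam : ℂ} {y y' : ℝ → ℂ} (h : ∀ t, HasDerivAt y (y' t) t)
    (h' : ∀ t, HasDerivAt y' (-lam * y t) t) : IsSol (fun _ => 0) lam y y' := by
  have c : Continuous y := continuous_iff_continuousAt.2 fun t => (h t).continuousAt
  have c' : Continuous y' := continuous_iff_continuousAt.2 fun t => (h' t).continuousAt
  refine ⟨c.continuousOn, c'.continuousOn, fun x _ => ?_, fun x _ => ?_⟩
  · rw [intervalIntegral.integral_eq_sub_of_hasDerivAt (fun t _ => h t)
      (c'.intervalIntegrable _ _)]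
    ring
  · have e : ∀ t, (((0 : ℝ) : ℂ) - lam) * y t = -lam * y t := fun t => by simp
    have := intervalIntegral.integral_eq_sub_of_hasDerivAt (fun t _ => h' t)
      ((c.const_mul (-lam)).intervalIntegrable 0 x)
    simp only [RCLike.ofReal_eq_complex_ofReal] at e ⊢
    simp only [e]
    rw [this]
    ring

lemma isSol_sin {z : ℂ} (hz : z ≠ 0) (x : ℝ) :
    IsSol (fun _ => 0) (z ^ 2) (fun t => Complex.sin (z * (x - t)) / z)
      (fun t => -Complex.cos (z * (x - t))) := by
  have hl : ∀ t : ℝ, HasDerivAt (fun t : ℝ => z * ((x : ℂ) - t)) (-z) t := fun t => by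
    simpa using ((Complex.ofRealCLM.hasDerivAt (x := t)).const_sub (x : ℂ)).const_mul z
  refine isSol_zero_of_hasDerivAt (fun t => ?_) fun t => ?_
  · exact (((Complex.hasDerivAt_sin _).comp t (hl t)).div_const z).congr_deriv (by field_simp)
  · exact ((Complex.hasDerivAt_cos _).comp t (hl t)).neg.congr_deriv (by field_simp)

lemma norm_sin_le (w : ℂ) : ‖Complex.sin w‖ ≤ Real.exp |w.im| := by
  have h1 : ‖Complex.exp (-w * Complex.I)‖ ≤ Real.exp |w.im| := by
    rw [Complex.norm_exp]
    simpa using le_abs_self w.im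
  have h2 : ‖Complex.exp (w * Complex.I)‖ ≤ Real.exp |w.im| := by
    rw [Complex.norm_exp]
    simpa using neg_le_abs w.im
  rw [Complex.sin, norm_div, norm_mul, Complex.norm_I, mul_one, Complex.norm_ofNat]
  linarith [norm_sub_le (Complex.exp (-w * Complex.I)) (Complex.exp (w * Complex.I))]

lemma norm_cos_le (w : ℂ) : ‖Complex.cos w‖ ≤ Real.exp |w.im| := by
  have h1 : ‖Complex.exp (-w * Complex.I)‖ ≤ Real.exp |w.im| := by
    rw [Complex.norm_exp]
    simpa using le_abs_self w.im
  have h2 : ‖Complex.exp (w * Complex.I)‖ ≤ Real.exp |w.im| := by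
    rw [Complex.norm_exp]
    simpa using neg_le_abs w.im
  rw [Complex.cos, norm_div, Complex.norm_ofNat]
  linarith [norm_add_le (Complex.exp (w * Complex.I)) (Complex.exp (-w * Complex.I))]

lemma abs_im_mul_ofReal {z : ℂ} {x : ℝ} (hx : 0 ≤ x) : |(z * x).im| = |z.im| * x := by
  simp [abs_mul, abs_of_nonneg hx]

/-- The Volterra equation for solutions. -/
lemma IsSol.eq_volterra {q : ℝ → ℝ} (hq : IntervalIntegrable q volume 0 Real.pi) {z : ℂ}
    (hz : z ≠ 0) {y y' : ℝ → ℂ} (hy : IsSol q (z ^ 2) y y') {x : ℝ}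
    (hx : x ∈ Icc (0 : ℝ) Real.pi) :
    y x = y 0 * Complex.cos (z * x) + y' 0 * (Complex.sin (z * x) / z) +
      ∫ t in (0 : ℝ)..x, (q t : ℂ) * (y t * (Complex.sin (z * (x - t)) / z)) := by
  have := hy.green hq (p := fun _ => 0) intervalIntegrable_const (isSol_sin hz x) hx
  simp only [sub_self, mul_zero, Complex.sin_zero, Complex.cos_zero, zero_div,
    Complex.ofReal_zero, sub_zero, RCLike.ofReal_zero, zero_sub, sub_neg_eq_add,
    sub_add_cancel, mul_neg, mul_one, zero_add] at this
  rw [this, add_comm (y 0 * _)]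
  rfl

lemma IsSol.norm_sub_le {q : ℝ → ℝ} (hq : IntervalIntegrable q volume 0 Real.pi) {z : ℂ}
    (hz : z ≠ 0) {y y' : ℝ → ℂ} (hy : IsSol q (z ^ 2) y y') {M : ℝ} (hM : 0 ≤ M)
    (h : ∀ t ∈ Icc (0 : ℝ) Real.pi, ‖y t‖ ≤ M * Real.exp (|z.im| * t)) {x : ℝ}
    (hx : x ∈ Icc (0 : ℝ) Real.pi) :
    ‖y x - (y 0 * Complex.cos (z * x) + y' 0 * (Complex.sin (z * x) / z))‖ ≤
      potNorm q / ‖z‖ * M * Real.exp (|z.im| * x) := by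
  have hz' : 0 < ‖z‖ := norm_pos_iff.2 hz
  rw [hy.eq_volterra hq hz hx, add_sub_cancel_left]
  have hk : IntervalIntegrable (fun t => (q t : ℂ)) volume 0 Real.pi := ⟨hq.1.ofReal, hq.2.ofReal⟩
  refine (norm_integral_mul_le hk hx (M := M * Real.exp (|z.im| * x) / ‖z‖) (by positivity)
    fun t ht => ?_).trans_eq ?_
  · have hs := norm_sin_le (z * ((x - t : ℝ) : ℂ))
    rw [abs_im_mul_ofReal (sub_nonneg.2 ht.2), Complex.ofReal_sub] at hs
    rw [norm_mul, norm_div, ← mul_div_assoc]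
    refine div_le_div_of_nonneg_right ?_ hz'.le
    calc ‖y t‖ * ‖Complex.sin (z * (x - t))‖
        ≤ M * Real.exp (|z.im| * t) * Real.exp (|z.im| * (x - t)) := by
          gcongr
          exact h t ⟨ht.1, ht.2.trans hx.2⟩
      _ = M * Real.exp (|z.im| * x) := by
          rw [mul_assoc, ← Real.exp_add]
          ring_nf
  · simp only [Complex.norm_real, Real.norm_eq_abs, potNorm]
    ring

lemma norm_free_le {z : ℂ} (hz : z ≠ 0) (a b : ℂ) {x : ℝ} (hx : 0 ≤ x) :
    ‖a * Complex.cos (z * x) + b * (Complex.sin (z * x) / z)‖ ≤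
      (‖a‖ + ‖b‖ / ‖z‖) * Real.exp (|z.im| * x) := by
  have hs := norm_sin_le (z * x)
  have hc := norm_cos_le (z * x)
  rw [abs_im_mul_ofReal hx] at hs hc
  have hz' : 0 < ‖z‖ := norm_pos_iff.2 hz
  calc _ ≤ ‖a‖ * ‖Complex.cos (z * x)‖ + ‖b‖ * (‖Complex.sin (z * x)‖ / ‖z‖) := by
        refine (norm_add_le _ _).trans_eq ?_
        rw [norm_mul, norm_mul, norm_div]
    _ ≤ ‖a‖ * Real.exp (|z.im| * x) + ‖b‖ * (Real.exp (|z.im| * x) / ‖z‖) := by gcongr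
    _ = _ := by ring

/-- The growth of solutions in the spectral parameter. -/
lemma IsSol.norm_le {q : ℝ → ℝ} (hq : IntervalIntegrable q volume 0 Real.pi) {z : ℂ}
    (hz : z ≠ 0) (hzA : 2 * potNorm q ≤ ‖z‖) {y y' : ℝ → ℂ} (hy : IsSol q (z ^ 2) y y') {x : ℝ}
    (hx : x ∈ Icc (0 : ℝ) Real.pi) :
    ‖y x‖ ≤ 2 * (‖y 0‖ + ‖y' 0‖ / ‖z‖) * Real.exp (|z.im| * x) := by
  have hz' : 0 < ‖z‖ := norm_pos_iff.2 hz
  have hc : ContinuousOn (fun t => ‖y t‖ * Real.exp (-(|z.im| * t))) (Icc 0 Real.pi) :=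
    hy.1.norm.mul (by fun_prop)
  obtain ⟨m, hm, hmax⟩ := isCompact_Icc.exists_isMaxOn ⟨_, zero_mem⟩ hc
  set M := ‖y m‖ * Real.exp (-(|z.im| * m))
  have hM : 0 ≤ M := by positivity
  have key : ∀ t, ‖y t‖ = ‖y t‖ * Real.exp (-(|z.im| * t)) * Real.exp (|z.im| * t) := fun t => by
    rw [mul_assoc, ← Real.exp_add, neg_add_cancel, Real.exp_zero, mul_one]
  have hle : ∀ t ∈ Icc (0 : ℝ) Real.pi, ‖y t‖ ≤ M * Real.exp (|z.im| * t) := fun t ht => by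
    rw [key t]
    gcongr
    exact hmax ht
  have h1 := hy.norm_sub_le hq hz hM hle hm
  have h2 := norm_free_le hz (y 0) (y' 0) hm.1
  have h3 : ‖y m‖ ≤ (‖y 0‖ + ‖y' 0‖ / ‖z‖ + potNorm q / ‖z‖ * M) * Real.exp (|z.im| * m) := by
    have := norm_le_norm_add_norm_sub'  (y m)
      (y 0 * Complex.cos (z * m) + y' 0 * (Complex.sin (z * m) / z))
    linarith
  have h4 : M ≤ ‖y 0‖ + ‖y' 0‖ / ‖z‖ + potNorm q / ‖z‖ * M := by
    rw [key m] at h3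
    exact le_of_mul_le_mul_right h3 (Real.exp_pos _)
  have h5 : potNorm q / ‖z‖ * M ≤ 1 / 2 * M := by
    refine mul_le_mul_of_nonneg_right ?_ hM
    rw [div_le_iff₀ hz']
    linarith
  refine (hle x hx).trans ?_
  gcongr
  linarith

lemma IsSol.abs_le {q : ℝ → ℝ} (hq : IntervalIntegrable q volume 0 Real.pi) {κ : ℝ}
    (hκ : 0 < κ) (hA : 2 * potNorm q ≤ κ) {y y' : ℝ → ℝ} (hy : IsSol q (-κ ^ 2) y y') {x : ℝ}
    (hx : x ∈ Icc (0 : ℝ) Real.pi) :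
    |y x| ≤ 2 * (|y 0| + |y' 0| / κ) * Real.exp (κ * x) ∧
    |y x - (y 0 * Real.cosh (κ * x) + y' 0 * (Real.sinh (κ * x) / κ))| ≤
      potNorm q / κ * (2 * (|y 0| + |y' 0| / κ)) * Real.exp (κ * x) := by
  have hz : (κ * Complex.I : ℂ) ≠ 0 := by simp [hκ.ne']
  have hn : ‖(κ * Complex.I : ℂ)‖ = κ := by simp [abs_of_pos hκ]
  have him : |(κ * Complex.I : ℂ).im| = κ := by simp [abs_of_pos hκ]
  have hsq : ((-κ ^ 2 : ℝ) : ℂ) = (κ * Complex.I) ^ 2 := by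
    rw [mul_pow, Complex.I_sq]
    push_cast
    ring
  have hyc := hy.ofReal
  rw [hsq] at hyc
  have hle := fun t ht => hyc.norm_le hq hz (hn.symm ▸ hA) (x := t) ht
  have h2 := hyc.norm_sub_le hq hz (by positivity) hle hx
  have e : (κ * Complex.I : ℂ) * x = ((κ * x : ℝ) : ℂ) * Complex.I := by push_cast; ring
  have h1 := hle x hx
  simp only [hn, him, Complex.norm_real, Real.norm_eq_abs] at h1 h2
  refine ⟨h1, ?_⟩
  rw [e, Complex.cos_mul_I, Complex.sin_mul_I, mul_div_mul_right _ _ Complex.I_ne_zero,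
    ← Complex.ofReal_cosh, ← Complex.ofReal_sinh] at h2
  norm_cast at h2

end SturmLiouville

namespace SturmLiouville

open BoundedContinuousFunction

variable {𝕜 : Type*} [RCLike 𝕜]

open Filter Topology

lemma eventually_eval_le (f : RatHN) :
    ∃ C, 0 ≤ C ∧ ∀ᶠ κ : ℝ in atTop, ¬ f.IsPole (-κ ^ 2) ∧ f.eval (-κ ^ 2) ≤ C := by
  refine ⟨|f.c| + ∑ j, f.γ j,
    add_nonneg (abs_nonneg _) (Finset.sum_nonneg fun j _ => (f.hγ j).le), ?_⟩
  have h : ∀ᶠ κ : ℝ in atTop, ∀ j, 1 - f.β j ≤ κ ^ 2 := eventually_all.2 fun j =>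
    (tendsto_pow_atTop two_ne_zero).eventually_ge_atTop _
  filter_upwards [h] with κ hκ
  refine ⟨?_, ?_⟩
  · rintro ⟨j, hj⟩
    linarith [hκ j]
  · have h1 : f.a * -κ ^ 2 ≤ 0 := mul_nonpos_of_nonneg_of_nonpos f.ha (by nlinarith [sq_nonneg κ])
    have h2 : ∑ j, f.γ j / (f.β j - -κ ^ 2) ≤ ∑ j, f.γ j := Finset.sum_le_sum fun j _ =>
      div_le_self (f.hγ j).le (by linarith [hκ j])
    rw [RatHN.eval]
    linarith [le_abs_self f.c]

/-- Lower bound for hyperbolic data that is bounded below. -/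
lemma le_cosh_add_sinh {κ g C : ℝ} (hκ : 1 ≤ κ) (hC : 0 ≤ C) (hg : -C ≤ g) (hκC : 8 * C ≤ κ) :
    (1 + |g| / κ) / 4 * Real.exp (κ * Real.pi) ≤
      1 * Real.cosh (κ * Real.pi) + g * (Real.sinh (κ * Real.pi) / κ) := by
  have hκ0 : 0 < κ := by linarith
  set E := Real.exp (κ * Real.pi)
  have hE : 0 < E := Real.exp_pos _
  have hpi : 3 ≤ κ * Real.pi := by nlinarith [Real.pi_gt_three]
  have hE2 : 2 ≤ E := by linarith [Real.add_one_le_exp (κ * Real.pi)]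
  have hEi : Real.exp (-(κ * Real.pi)) * E = 1 := by
    rw [← Real.exp_add, neg_add_cancel, Real.exp_zero]
  have he : 0 < Real.exp (-(κ * Real.pi)) := Real.exp_pos _
  have he' : Real.exp (-(κ * Real.pi)) ≤ E / 2 := by nlinarith
  have hcosh : E / 2 ≤ Real.cosh (κ * Real.pi) := by rw [Real.cosh_eq]; linarith
  have hsinh : E / 4 ≤ Real.sinh (κ * Real.pi) := by rw [Real.sinh_eq]; linarith
  have hsinh' : Real.sinh (κ * Real.pi) ≤ E / 2 := by rw [Real.sinh_eq]; linarith
  have key : |g| * (E / 4) - C * E ≤ g * Real.sinh (κ * Real.pi) := by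
    rcases le_or_gt 0 g with h | h
    · rw [abs_of_nonneg h]
      nlinarith
    · rw [abs_of_neg h]
      nlinarith
  have key2 : (|g| * (E / 4) - C * E) / κ ≤ g * (Real.sinh (κ * Real.pi) / κ) := by
    rw [← mul_div_assoc g]
    exact div_le_div_of_nonneg_right key hκ0.le
  have key3 : C * E / κ ≤ E / 8 := by
    rw [div_le_iff₀ hκ0]
    nlinarith
  have e : (|g| * (E / 4) - C * E) / κ = |g| / κ / 4 * E - C * E / κ := by ring
  rw [e] at key2
  linarith

section

variable {q : ℝ → ℝ} (hq : IntervalIntegrable q volume 0 Real.pi)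

lemma endVal_eq_mul (f : RatHN) {lam : ℝ} (h : ¬ f.IsPole lam) :
    endVal hq f lam = f.den lam * sol hq lam 1 (-f.eval lam) Real.pi ∧
    endDer hq f lam = f.den lam * dsol hq lam 1 (-f.eval lam) Real.pi := by
  rw [endVal, endDer, f.num_eq_eval_mul h, sol_linear hq lam (f.den lam),
    dsol_linear hq lam (f.den lam), sol_linear hq lam 1 (-f.eval lam),
    dsol_linear hq lam 1 (-f.eval lam)]
  simp only [BoundedContinuousFunction.add_apply, BoundedContinuousFunction.smul_apply, smul_eq_mul]
  constructor <;> ring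

/-- The solution satisfying the left boundary condition grows exponentially. -/
lemma eventually_abs_sol_le (f : RatHN) : ∀ᶠ κ : ℝ in atTop,
    ¬ f.IsPole (-κ ^ 2) ∧ 0 < sol hq (-κ ^ 2) 1 (-f.eval (-κ ^ 2)) Real.pi ∧
    ∀ x ∈ Icc (0 : ℝ) Real.pi, |sol hq (-κ ^ 2) 1 (-f.eval (-κ ^ 2)) x| ≤
      16 * Real.exp (κ * (x - Real.pi)) * sol hq (-κ ^ 2) 1 (-f.eval (-κ ^ 2)) Real.pi := by
  obtain ⟨C, hC, hev⟩ := eventually_eval_le f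
  filter_upwards [hev, eventually_ge_atTop 1, eventually_ge_atTop (8 * C),
    eventually_ge_atTop (16 * potNorm q)] with κ ⟨hp, hf⟩ h1 h2 h3
  have hA := potNorm_nonneg q
  have hκ : 0 < κ := by linarith
  have hle := fun x hx => (isSol_sol hq (-κ ^ 2) 1 (-f.eval (-κ ^ 2))).abs_le hq hκ
    (by linarith) (x := x) hx
  have hlow := le_cosh_add_sinh h1 hC (neg_le_neg hf) h2
  simp only [sol_zero, dsol_zero, abs_one] at hle
  set g := -f.eval (-κ ^ 2)
  set y := sol hq (-κ ^ 2) 1 g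
  set N := 1 + |g| / κ
  have hN : 1 ≤ N := le_add_of_nonneg_right (by positivity)
  have hE : 0 < Real.exp (κ * Real.pi) := Real.exp_pos _
  have hb : N / 8 * Real.exp (κ * Real.pi) ≤ y Real.pi := by
    have h4 := (abs_le.1 (hle _ pi_mem).2).1
    have h5 : potNorm q / κ * (2 * N) * Real.exp (κ * Real.pi) ≤
        N / 8 * Real.exp (κ * Real.pi) := by
      refine mul_le_mul_of_nonneg_right ?_ hE.le
      have : potNorm q / κ ≤ 1 / 16 := by
        rw [div_le_iff₀ hκ]
        linarith
      nlinarith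
    linarith
  refine ⟨hp, lt_of_lt_of_le (by positivity) hb, fun x hx => (hle x hx).1.trans ?_⟩
  calc 2 * N * Real.exp (κ * x)
      = 16 * Real.exp (κ * (x - Real.pi)) * (N / 8 * Real.exp (κ * Real.pi)) := by
        rw [mul_sub, Real.exp_sub]
        field_simp
        ring
    _ ≤ _ := by gcongr

/-- The solution `θ` behaves like `cosh`; in particular it is positive. -/
lemma eventually_sol_pos : ∀ᶠ κ : ℝ in atTop,
    ∀ x ∈ Icc (0 : ℝ) Real.pi, 0 < sol hq (-κ ^ 2) 1 0 x := by
  filter_upwards [eventually_ge_atTop 1, eventually_ge_atTop (8 * potNorm q)] with κ h1 h2 x hx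
  have hA := potNorm_nonneg q
  have hκ : 0 < κ := by linarith
  have h := ((isSol_sol hq (-κ ^ 2) 1 0).abs_le hq hκ (by linarith) hx).2
  simp only [sol_zero, dsol_zero, abs_one, abs_zero, zero_div, add_zero, mul_one, zero_mul,
    one_mul] at h
  have h3 : potNorm q / κ ≤ 1 / 8 := by
    rw [div_le_iff₀ hκ]
    linarith
  have h4 : Real.exp (κ * x) / 2 < Real.cosh (κ * x) := by
    rw [Real.cosh_eq]
    linarith [Real.exp_pos (-(κ * x))]
  have h5 := (abs_le.1 h).1
  nlinarith [Real.exp_pos (κ * x)]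

lemma eventually_abs_phi_le : ∀ᶠ κ : ℝ in atTop, ∀ x ∈ Icc (0 : ℝ) Real.pi,
    |sol hq (-κ ^ 2) 0 1 x| ≤ 2 / κ * Real.exp (κ * x) := by
  filter_upwards [eventually_gt_atTop 0, eventually_ge_atTop (2 * potNorm q)] with κ h1 h2 x hx
  have h := ((isSol_sol hq (-κ ^ 2) 0 1).abs_le hq h1 (by linarith) hx).1
  simp only [sol_zero, dsol_zero, abs_one, abs_zero, zero_add, mul_one_div] at h
  exact h

/-- Solutions seen from the right endpoint. -/
lemma sol_reflect (lam a b : ℝ) {s : ℝ} (hs : s ∈ Icc (0 : ℝ) Real.pi) :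
    sol hq lam a b (Real.pi - s) =
      sol hq lam a b Real.pi * sol (intervalIntegrable_reflect hq) lam 1 0 s -
      dsol hq lam a b Real.pi * sol (intervalIntegrable_reflect hq) lam 0 1 s := by
  have h := (((isSol_sol hq lam a b).reflect hq).eq_sol (intervalIntegrable_reflect hq) hs).1
  simp only [sub_zero] at h
  rw [sol_linear (intervalIntegrable_reflect hq)] at h
  rw [h]
  simp only [BoundedContinuousFunction.add_apply, BoundedContinuousFunction.smul_apply, smul_eq_mul]
  ring

lemma sol_ofReal (lam a b : ℝ) {x : ℝ} (hx : x ∈ Icc (0 : ℝ) Real.pi) :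
    (sol hq lam a b x : ℂ) = sol hq (lam : ℂ) a b x := by
  have := ((isSol_sol hq lam a b).ofReal.eq_sol hq hx).1
  simpa using this

end

/-- The cross product of the fundamental systems of two potentials. -/
def cross (𝕜 : Type*) [RCLike 𝕜] {p₁ p₂ : ℝ → ℝ} (hp₁ : IntervalIntegrable p₁ volume 0 Real.pi)
    (hp₂ : IntervalIntegrable p₂ volume 0 Real.pi) (s : ℝ) (lam : 𝕜) : 𝕜 :=
  sol hp₁ lam 0 1 s * sol hp₂ lam 1 0 s - sol hp₁ lam 1 0 s * sol hp₂ lam 0 1 s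

lemma differentiable_cross {p₁ p₂ : ℝ → ℝ} (hp₁ : IntervalIntegrable p₁ volume 0 Real.pi)
    (hp₂ : IntervalIntegrable p₂ volume 0 Real.pi) (s : ℝ) :
    Differentiable ℂ fun z : ℂ => cross ℂ hp₁ hp₂ s (z ^ 2) := by
  have h : ∀ {p : ℝ → ℝ} (hp : IntervalIntegrable p volume 0 Real.pi) (a b : ℂ),
      Differentiable ℂ fun z : ℂ => sol hp (z ^ 2) a b s := fun hp a b z =>
    (analyticAt_eval (analyticAt_sol hp a b (z ^ 2)) s).differentiableAt.comp z
      (differentiable_pow 2 z)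
  exact ((h _ _ _).mul (h _ _ _)).sub ((h _ _ _).mul (h _ _ _))

lemma norm_cross_le {p₁ p₂ : ℝ → ℝ} (hp₁ : IntervalIntegrable p₁ volume 0 Real.pi)
    (hp₂ : IntervalIntegrable p₂ volume 0 Real.pi) {s : ℝ} (hs : s ∈ Icc (0 : ℝ) Real.pi) {z : ℂ}
    (h0 : z ≠ 0) (h₁ : 2 * potNorm p₁ ≤ ‖z‖) (h₂ : 2 * potNorm p₂ ≤ ‖z‖) :
    ‖cross ℂ hp₁ hp₂ s (z ^ 2)‖ ≤ 8 / ‖z‖ * Real.exp (2 * |z.im| * s) := by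
  have h : ∀ {p : ℝ → ℝ} (hp : IntervalIntegrable p volume 0 Real.pi), 2 * potNorm p ≤ ‖z‖ →
      ‖sol hp (z ^ 2) 1 0 s‖ ≤ 2 * Real.exp (|z.im| * s) ∧
      ‖sol hp (z ^ 2) 0 1 s‖ ≤ 2 / ‖z‖ * Real.exp (|z.im| * s) := fun {p} hp h => by
    have e1 := (isSol_sol hp (z ^ 2) 1 0).norm_le hp h0 h hs
    have e2 := (isSol_sol hp (z ^ 2) 0 1).norm_le hp h0 h hs
    simp only [sol_zero, dsol_zero, norm_one, norm_zero, zero_div, add_zero, mul_one, zero_add,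
      mul_one_div] at e1 e2
    exact ⟨e1, e2⟩
  have g₁ := h hp₁ h₁
  have g₂ := h hp₂ h₂
  have hz : 0 < ‖z‖ := norm_pos_iff.2 h0
  calc _ ≤ ‖sol hp₁ (z ^ 2) 0 1 s‖ * ‖sol hp₂ (z ^ 2) 1 0 s‖ +
        ‖sol hp₁ (z ^ 2) 1 0 s‖ * ‖sol hp₂ (z ^ 2) 0 1 s‖ := by
        rw [← norm_mul, ← norm_mul]
        exact _root_.norm_sub_le _ _
    _ ≤ 2 / ‖z‖ * Real.exp (|z.im| * s) * (2 * Real.exp (|z.im| * s)) +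
        2 * Real.exp (|z.im| * s) * (2 / ‖z‖ * Real.exp (|z.im| * s)) := by
        gcongr
        exacts [g₁.2, g₂.1, g₁.1, g₂.2]
    _ = _ := by
        have : Real.exp (2 * |z.im| * s) = Real.exp (|z.im| * s) * Real.exp (|z.im| * s) := by
          rw [← Real.exp_add]
          ring_nf
        rw [this]
        ring

/-- An even entire function of exponential type that is small on the coordinate axes vanishes. -/
lemma eq_zero_of_even_of_exponential_type {F : ℂ → ℂ} (hF : Differentiable ℂ F)
    (heven : ∀ z, F (-z) = F z) {B : ℝ}
    (hexp : ∀ᶠ z in Bornology.cobounded ℂ, ‖F z‖ ≤ Real.exp (B * ‖z‖))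
    (hre : Tendsto (fun x : ℝ => F x) atTop (𝓝 0))
    (him : Tendsto (fun x : ℝ => F (x * Complex.I)) atTop (𝓝 0)) (z : ℂ) : F z = 0 := by
  obtain ⟨R, hR⟩ := (him.norm.eventually_le_const (u := 1) (by simp)).exists_forall_of_atTop
  obtain ⟨C, hC⟩ := (isCompact_Icc (a := 0) (b := R)).exists_bound_of_continuousOn
    (f := fun x : ℝ => F (x * Complex.I)) (hF.continuous.comp (by fun_prop)).continuousOn
  have hpos : ∀ x : ℝ, 0 ≤ x → ‖F (x * Complex.I)‖ ≤ max 1 C := fun x hx => by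
    rcases le_total R x with h | h
    · exact (hR x h).trans (le_max_left _ _)
    · exact (hC x ⟨hx, h⟩).trans (le_max_right _ _)
  have himb : ∀ x : ℝ, ‖F (x * Complex.I)‖ ≤ max 1 C := fun x => by
    rcases le_total 0 x with h | h
    · exact hpos x h
    · have := hpos (-x) (neg_nonneg.2 h)
      rwa [Complex.ofReal_neg, neg_mul, heven] at this
  have hhalf : ∀ z : ℂ, 0 ≤ z.re → ‖F z‖ ≤ max 1 C := fun z hz =>
    PhragmenLindelof.right_half_plane_of_tendsto_zero_on_real hF.diffContOnCl
      ⟨1, one_lt_two, B, Asymptotics.IsBigO.of_bound 1 <| by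
        filter_upwards [hexp.filter_mono inf_le_left] with w hw
        rw [Real.rpow_one, one_mul, Real.norm_eq_abs, Real.abs_exp]
        exact hw⟩ hre himb hz
  have hbdd : Bornology.IsBounded (range F) := by
    refine (Metric.isBounded_closedBall (x := (0 : ℂ)) (r := max 1 C)).subset ?_
    rintro _ ⟨w, rfl⟩
    rw [mem_closedBall_zero_iff]
    rcases le_total 0 w.re with h | h
    · exact hhalf w h
    · rw [← heven]
      exact hhalf _ (by simpa using h)
  have hconst : ∀ w, F w = F z := fun w => hF.apply_eq_apply_of_bounded hbdd w z
  simp only [hconst] at hre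
  exact tendsto_nhds_unique tendsto_const_nhds hre

section

variable {q₁ q₂ : ℝ → ℝ} (hq₁ : IntervalIntegrable q₁ volume 0 Real.pi)
  (hq₂ : IntervalIntegrable q₂ volume 0 Real.pi) {f₁ f₂ : RatHN}

lemma eventually_abs_cross_le
    (hw : ∀ lam, endDer hq₁ f₁ lam * endVal hq₂ f₂ lam = endVal hq₁ f₁ lam * endDer hq₂ f₂ lam)
    {s : ℝ} (hs : s ∈ Icc (0 : ℝ) Real.pi) : ∀ᶠ κ : ℝ in atTop,
    |cross ℝ (intervalIntegrable_reflect hq₁) (intervalIntegrable_reflect hq₂) s (-κ ^ 2)| ≤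
      64 / κ := by
  filter_upwards [eventually_abs_sol_le hq₁ f₁, eventually_abs_sol_le hq₂ f₂,
    eventually_abs_phi_le (intervalIntegrable_reflect hq₁),
    eventually_abs_phi_le (intervalIntegrable_reflect hq₂), eventually_gt_atTop 0]
    with κ ⟨hp₁, hu₁, hy₁⟩ ⟨hp₂, hu₂, hy₂⟩ hφ₁ hφ₂ hκ
  have hs' : Real.pi - s ∈ Icc (0 : ℝ) Real.pi := ⟨by linarith [hs.2], by linarith [hs.1]⟩
  have hw' := hw (-κ ^ 2)
  rw [(endVal_eq_mul hq₁ f₁ hp₁).1, (endVal_eq_mul hq₁ f₁ hp₁).2, (endVal_eq_mul hq₂ f₂ hp₂).1,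
    (endVal_eq_mul hq₂ f₂ hp₂).2] at hw'
  replace hy₁ := hy₁ _ hs'
  replace hy₂ := hy₂ _ hs'
  replace hφ₁ := hφ₁ _ hs
  replace hφ₂ := hφ₂ _ hs
  have r₁ := sol_reflect hq₁ (-κ ^ 2) 1 (-f₁.eval (-κ ^ 2)) hs
  have r₂ := sol_reflect hq₂ (-κ ^ 2) 1 (-f₂.eval (-κ ^ 2)) hs
  have hd₁ : f₁.den (-κ ^ 2) ≠ 0 := fun e => hp₁ ((f₁.den_eq_zero_iff _).1 e)
  have hd₂ : f₂.den (-κ ^ 2) ≠ 0 := fun e => hp₂ ((f₂.den_eq_zero_iff _).1 e)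
  have hexp : Real.exp (κ * (Real.pi - s - Real.pi)) * Real.exp (κ * s) = 1 := by
    rw [← Real.exp_add, ← Real.exp_zero]
    ring_nf
  rw [cross]
  set u₁ := sol hq₁ (-κ ^ 2) 1 (-f₁.eval (-κ ^ 2)) Real.pi
  set u₂ := sol hq₂ (-κ ^ 2) 1 (-f₂.eval (-κ ^ 2)) Real.pi
  set v₁ := dsol hq₁ (-κ ^ 2) 1 (-f₁.eval (-κ ^ 2)) Real.pi
  set v₂ := dsol hq₂ (-κ ^ 2) 1 (-f₂.eval (-κ ^ 2)) Real.pi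
  set y₁ := sol hq₁ (-κ ^ 2) 1 (-f₁.eval (-κ ^ 2)) (Real.pi - s)
  set y₂ := sol hq₂ (-κ ^ 2) 1 (-f₂.eval (-κ ^ 2)) (Real.pi - s)
  set θ₁ := sol (intervalIntegrable_reflect hq₁) (-κ ^ 2) 1 0 s
  set θ₂ := sol (intervalIntegrable_reflect hq₂) (-κ ^ 2) 1 0 s
  set φ₁ := sol (intervalIntegrable_reflect hq₁) (-κ ^ 2) 0 1 s
  set φ₂ := sol (intervalIntegrable_reflect hq₂) (-κ ^ 2) 0 1 s
  have hv : v₁ * u₂ = u₁ * v₂ := by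
    refine mul_left_cancel₀ (mul_ne_zero hd₁ hd₂) ?_
    linear_combination hw'
  have hG : (φ₁ * θ₂ - θ₁ * φ₂) * (u₁ * u₂) = φ₁ * y₂ * u₁ - y₁ * φ₂ * u₂ := by
    rw [r₁, r₂]
    linear_combination -φ₁ * φ₂ * hv
  have hu : 0 < u₁ * u₂ := mul_pos hu₁ hu₂
  refine le_of_mul_le_mul_right ?_ hu
  rw [← abs_of_pos hu, ← abs_mul, hG, abs_of_pos hu]
  calc |φ₁ * y₂ * u₁ - y₁ * φ₂ * u₂| ≤ |φ₁| * |y₂| * u₁ + |y₁| * |φ₂| * u₂ := by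
        refine (abs_sub _ _).trans_eq ?_
        rw [abs_mul, abs_mul, abs_mul, abs_mul, abs_of_pos hu₁, abs_of_pos hu₂]
    _ ≤ 2 / κ * Real.exp (κ * s) * (16 * Real.exp (κ * (Real.pi - s - Real.pi)) * u₂) * u₁ +
        16 * Real.exp (κ * (Real.pi - s - Real.pi)) * u₁ * (2 / κ * Real.exp (κ * s)) * u₂ := by
        gcongr
    _ = 64 / κ * (u₁ * u₂) *
        (Real.exp (κ * (Real.pi - s - Real.pi)) * Real.exp (κ * s)) := by ring
    _ = 64 / κ * (u₁ * u₂) := by rw [hexp, mul_one]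

/-- If the Weyl functions coincide, then so do the quotients of the fundamental solutions. -/
theorem cross_eq_zero
    (hw : ∀ lam, endDer hq₁ f₁ lam * endVal hq₂ f₂ lam = endVal hq₁ f₁ lam * endDer hq₂ f₂ lam)
    {s : ℝ} (hs : s ∈ Icc (0 : ℝ) Real.pi) (κ : ℝ) :
    cross ℝ (intervalIntegrable_reflect hq₁) (intervalIntegrable_reflect hq₂) s (-κ ^ 2) = 0 := by
  set p₁ := intervalIntegrable_reflect hq₁
  set p₂ := intervalIntegrable_reflect hq₂
  have hofReal : ∀ x : ℝ, cross ℂ p₁ p₂ s ((x * Complex.I) ^ 2) = (cross ℝ p₁ p₂ s (-x ^ 2) : ℂ) := by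
    intro x
    have e : ((x : ℂ) * Complex.I) ^ 2 = ((-x ^ 2 : ℝ) : ℂ) := by
      rw [mul_pow, Complex.I_sq]
      push_cast
      ring
    rw [e, cross, cross]
    push_cast
    rw [sol_ofReal p₁ _ _ _ hs, sol_ofReal p₁ _ _ _ hs, sol_ofReal p₂ _ _ _ hs,
      sol_ofReal p₂ _ _ _ hs]
    push_cast
    rfl
  have htend : ∀ c : ℝ, Tendsto (fun x : ℝ => c / x) atTop (𝓝 0) := fun c =>
    tendsto_const_nhds.div_atTop tendsto_id
  have hzero := eq_zero_of_even_of_exponential_type (differentiable_cross p₁ p₂ s)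
    (fun z => by simp only [neg_sq]) (B := 2 * Real.pi) ?_ ?_ ?_ (κ * Complex.I)
  · rw [hofReal] at hzero
    exact_mod_cast hzero
  · have hev : ∀ c : ℝ, ∀ᶠ z : ℂ in Bornology.cobounded ℂ, c ≤ ‖z‖ := fun c =>
      tendsto_norm_cobounded_atTop.eventually_ge_atTop c
    filter_upwards [hev 8, hev (2 * potNorm fun s => q₁ (Real.pi - s)),
      hev (2 * potNorm fun s => q₂ (Real.pi - s))] with z h8 h₁ h₂
    have h0 : 0 < ‖z‖ := by linarith
    refine (norm_cross_le p₁ p₂ hs (norm_pos_iff.1 h0) h₁ h₂).trans ?_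
    calc 8 / ‖z‖ * Real.exp (2 * |z.im| * s) ≤ 1 * Real.exp (2 * Real.pi * ‖z‖) := by
          refine mul_le_mul ((div_le_one h0).2 h8) (Real.exp_le_exp.2 ?_) (Real.exp_pos _).le
            zero_le_one
          · have := mul_le_mul (Complex.abs_im_le_norm z) hs.2 hs.1 (norm_nonneg z)
            linarith
      _ = _ := one_mul _
  · refine squeeze_zero_norm' ?_ (htend 8)
    filter_upwards [eventually_gt_atTop 0,
      eventually_ge_atTop (2 * potNorm fun s => q₁ (Real.pi - s)),
      eventually_ge_atTop (2 * potNorm fun s => q₂ (Real.pi - s))]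
      with x h0 h₁ h₂
    have hn : ‖(x : ℂ)‖ = x := by rw [Complex.norm_real, Real.norm_of_nonneg h0.le]
    have := norm_cross_le p₁ p₂ hs (z := x) (by exact_mod_cast h0.ne') (hn.symm ▸ h₁) (hn.symm ▸ h₂)
    simpa [abs_of_pos h0] using this
  · refine squeeze_zero_norm' ?_ (htend 64)
    filter_upwards [eventually_abs_cross_le hq₁ hq₂ hw hs] with x hx
    rw [hofReal, Complex.norm_real]
    exact hx

end

end SturmLiouville

namespace SturmLiouville

open BoundedContinuousFunction

variable {𝕜 : Type*} [RCLike 𝕜]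

open Filter Topology

lemma hasDerivAt_sol {q : ℝ → ℝ} (hq : IntervalIntegrable q volume 0 Real.pi) (lam a b : ℝ)
    {x : ℝ} (hx : x ∈ Ioo (0 : ℝ) Real.pi) :
    HasDerivAt (sol hq lam a b) (dsol hq lam a b x) x := by
  have h := ((dsol hq lam a b).continuous.integral_hasStrictDerivAt 0 x).hasDerivAt.const_add a
  refine h.congr_of_eventuallyEq ?_
  filter_upwards [isOpen_Ioo.mem_nhds hx] with t ht
  have := (isSol_sol hq lam a b).2.2.1 t (Ioo_subset_Icc_self ht)
  rwa [sol_zero] at this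

section

variable {p₁ p₂ : ℝ → ℝ} (hp₁ : IntervalIntegrable p₁ volume 0 Real.pi)
  (hp₂ : IntervalIntegrable p₂ volume 0 Real.pi)

lemma sol_eq_sol_of_cross_eq_zero {lam : ℝ}
    (h₁ : ∀ x ∈ Icc (0 : ℝ) Real.pi, 0 < sol hp₁ lam 1 0 x)
    (h₂ : ∀ x ∈ Icc (0 : ℝ) Real.pi, 0 < sol hp₂ lam 1 0 x)
    (h : ∀ x ∈ Icc (0 : ℝ) Real.pi, cross ℝ hp₁ hp₂ x lam = 0) {x : ℝ}
    (hx : x ∈ Ioo (0 : ℝ) Real.pi) : sol hp₁ lam 1 0 x = sol hp₂ lam 1 0 x := by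
  have hd : ∀ {p : ℝ → ℝ} (hp : IntervalIntegrable p volume 0 Real.pi), 0 < sol hp lam 1 0 x →
      HasDerivAt (fun t => sol hp lam 0 1 t / sol hp lam 1 0 t) (1 / sol hp lam 1 0 x ^ 2) x := by
    intro p hp h
    have hW := (isSol_sol hp lam 0 1).wronskian hp (isSol_sol hp lam 1 0) (Ioo_subset_Icc_self hx)
    simp only [sol_zero, dsol_zero, mul_one, mul_zero, sub_zero] at hW
    exact ((hasDerivAt_sol hp lam 0 1 hx).div (hasDerivAt_sol hp lam 1 0 hx) h.ne').congr_deriv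
      (by rw [hW])
  have hpos₁ := h₁ x (Ioo_subset_Icc_self hx)
  have hpos₂ := h₂ x (Ioo_subset_Icc_self hx)
  have he : (fun t => sol hp₁ lam 0 1 t / sol hp₁ lam 1 0 t) =ᶠ[𝓝 x]
      fun t => sol hp₂ lam 0 1 t / sol hp₂ lam 1 0 t := by
    filter_upwards [isOpen_Ioo.mem_nhds hx] with t ht
    have ht' := Ioo_subset_Icc_self ht
    rw [div_eq_div_iff (h₁ t ht').ne' (h₂ t ht').ne']
    have := h t ht'
    rw [cross] at this
    linear_combination this
  have hu := (hd hp₁ hpos₁).unique ((hd hp₂ hpos₂).congr_of_eventuallyEq he)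
  rw [div_eq_div_iff (by positivity) (by positivity), one_mul, one_mul] at hu
  exact ((pow_left_inj₀ hpos₂.le hpos₁.le two_ne_zero).1 hu).symm

/-- A potential is determined by one positive solution. -/
lemma ae_eq_of_sol_eq {lam : ℝ} (h₁ : ∀ x ∈ Icc (0 : ℝ) Real.pi, 0 < sol hp₁ lam 1 0 x)
    (h : ∀ x ∈ Ioo (0 : ℝ) Real.pi, sol hp₁ lam 1 0 x = sol hp₂ lam 1 0 x) :
    ∀ᵐ x : ℝ, x ∈ Ioo 0 Real.pi → p₁ x = p₂ x := by
  have s₁ := isSol_sol hp₁ lam 1 0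
  have s₂ := isSol_sol hp₂ lam 1 0
  have hder : ∀ x ∈ Ioo (0 : ℝ) Real.pi, dsol hp₁ lam 1 0 x = dsol hp₂ lam 1 0 x := by
    intro x hx
    refine (hasDerivAt_sol hp₁ lam 1 0 hx).unique
      ((hasDerivAt_sol hp₂ lam 1 0 hx).congr_of_eventuallyEq ?_)
    filter_upwards [isOpen_Ioo.mem_nhds hx] with t ht
    exact h t ht
  filter_upwards [(s₁.intervalIntegrable_pot_mul hp₁).ae_hasDerivAt_integral,
    (s₂.intervalIntegrable_pot_mul hp₂).ae_hasDerivAt_integral] with x d₁ d₂ hx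
  have hxI := Ioo_subset_Icc_self hx
  have hxu : x ∈ uIcc 0 Real.pi := by rwa [uIcc_of_le Real.pi_pos.le]
  have hu := (d₁ hxu 0 left_mem_uIcc).unique ((d₂ hxu 0 left_mem_uIcc).congr_of_eventuallyEq ?_)
  · rw [h x hx] at hu
    have hne : sol hp₂ lam 1 0 x ≠ 0 := by
      rw [← h x hx]
      exact (h₁ x hxI).ne'
    have := mul_right_cancel₀ hne hu
    simpa using this
  · filter_upwards [isOpen_Ioo.mem_nhds hx] with t ht
    have e₁ := s₁.2.2.2 t (Ioo_subset_Icc_self ht)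
    have e₂ := s₂.2.2.2 t (Ioo_subset_Icc_self ht)
    rw [dsol_zero, zero_add] at e₁ e₂
    rw [← e₁, ← e₂, hder t ht]

end

/-- The Weyl function determines the potential. -/
theorem ae_eq_of_weyl_eq {q₁ q₂ : ℝ → ℝ} (hq₁ : IntervalIntegrable q₁ volume 0 Real.pi)
    (hq₂ : IntervalIntegrable q₂ volume 0 Real.pi) {f₁ f₂ : RatHN}
    (hw : ∀ lam, endDer hq₁ f₁ lam * endVal hq₂ f₂ lam = endVal hq₁ f₁ lam * endDer hq₂ f₂ lam) :
    ∀ᵐ x : ℝ, x ∈ Ioo 0 Real.pi → q₁ x = q₂ x := by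
  obtain ⟨κ, h₁, h₂⟩ := ((eventually_sol_pos (intervalIntegrable_reflect hq₁)).and
    (eventually_sol_pos (intervalIntegrable_reflect hq₂))).exists
  have h := ae_eq_of_sol_eq _ _ h₁ fun x hx => sol_eq_sol_of_cross_eq_zero _ _ h₁ h₂
    (fun s hs => cross_eq_zero hq₁ hq₂ hw hs κ) hx
  have := (Measure.measurePreserving_sub_left volume Real.pi).quasiMeasurePreserving.ae h
  filter_upwards [this] with x hx hxI
  simpa using hx ⟨by linarith [hxI.2], by linarith [hxI.1]⟩

lemma IsSol.congr_ae {q₁ q₂ : ℝ → ℝ} (h : ∀ᵐ x : ℝ, x ∈ Ioo 0 Real.pi → q₁ x = q₂ x) {lam : ℝ}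
    {y y' : ℝ → ℝ} (hy : IsSol q₁ lam y y') : IsSol q₂ lam y y' := by
  refine ⟨hy.1, hy.2.1, hy.2.2.1, fun x hx => ?_⟩
  rw [hy.2.2.2 x hx]
  congr 1
  refine intervalIntegral.integral_congr_ae ?_
  have hpi : ∀ᵐ t : ℝ, t ≠ Real.pi := by simp [ae_iff]
  filter_upwards [h, hpi] with t ht htpi hts
  rw [uIoc_of_le hx.1] at hts
  rw [ht ⟨hts.1, lt_of_le_of_ne (hts.2.trans hx.2) htpi⟩]

/-- The Weyl function determines the boundary condition at the left endpoint. -/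
theorem num_mul_den_eq {q₁ q₂ : ℝ → ℝ} (hq₁ : IntervalIntegrable q₁ volume 0 Real.pi)
    (hq₂ : IntervalIntegrable q₂ volume 0 Real.pi) {f₁ f₂ : RatHN}
    (hw : ∀ lam, endDer hq₁ f₁ lam * endVal hq₂ f₂ lam = endVal hq₁ f₁ lam * endDer hq₂ f₂ lam)
    (lam : ℝ) : f₁.num lam * f₂.den lam = f₁.den lam * f₂.num lam := by
  have h := ae_eq_of_weyl_eq hq₁ hq₂ hw
  have hW := ((isSol_sol hq₁ lam (f₁.den lam) (-f₁.num lam)).congr_ae h).wronskian hq₂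
    (isSol_sol hq₂ lam (f₂.den lam) (-f₂.num lam)) pi_mem
  have := hw lam
  simp only [endVal, endDer] at this
  simp only [sol_zero, dsol_zero] at hW
  linear_combination hW - this

end SturmLiouville

namespace RatHN

lemma ext_of_num_mul_den_eq {f g : RatHN} (h : ∀ lam, f.num lam * g.den lam = f.den lam * g.num lam) :
    f = g := by
  have hpole : ∀ {f g : RatHN}, (∀ lam, f.num lam * g.den lam = f.den lam * g.num lam) →
      range f.β ⊆ range g.β := by
    rintro f g h _ ⟨j, rfl⟩
    have h1 := h (f.β j)
    rw [(f.den_eq_zero_iff _).2 ⟨j, rfl⟩, zero_mul] at h1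
    exact (g.den_eq_zero_iff _).1
      ((mul_eq_zero.1 h1).resolve_left (f.num_ne_zero_of_isPole ⟨j, rfl⟩))
  have hrange : range f.β = range g.β :=
    (hpole h).antisymm (hpole fun lam => by linear_combination -h lam)
  have hn : f.n = g.n := by
    have h1 := Nat.card_range_of_injective f.hβ.injective
    have h2 := Nat.card_range_of_injective g.hβ.injective
    rw [hrange] at h1
    simpa using h1.symm.trans h2
  obtain ⟨a, c, n, γ, β, ha, hγ, hβ⟩ := f
  obtain ⟨a', c', n', γ', β', ha', hγ', hβ'⟩ := g
  simp only at hn hrange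
  subst hn
  obtain rfl : β = β' := (hβ.range_inj hβ').1 hrange
  set f : RatHN := ⟨a, c, n, γ, β, ha, hγ, hβ⟩
  set g : RatHN := ⟨a', c', n, γ', β, ha', hγ', hβ'⟩
  have hden : ∀ lam, g.den lam = f.den lam := fun _ => rfl
  have hnum' : ∀ᶠ lam in Filter.cofinite, f.num lam = g.num lam ∧ f.den lam ≠ 0 := by
    have hfin : {lam | f.IsPole lam}.Finite := finite_range f.β
    filter_upwards [hfin.compl_mem_cofinite] with lam hl
    have h0 : f.den lam ≠ 0 := fun e => hl ((f.den_eq_zero_iff _).1 e)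
    refine ⟨mul_right_cancel₀ h0 ?_, h0⟩
    rw [← hden, h, mul_comm]
    rfl
  have hcont : ∀ f : RatHN, Continuous f.num := fun f =>
    continuous_iff_continuousAt.2 fun x => (f.analyticAt_num x).continuousAt
  have hnum : f.num = g.num := by
    refine (hcont f).ext_on (s := {lam | f.num lam = g.num lam}) ?_ (hcont g) fun _ h => h
    have hfin : {lam | f.num lam = g.num lam}ᶜ.Finite :=
      Filter.mem_cofinite.1 (hnum'.mono fun _ h => h.1)
    simpa only [compl_compl] using Set.Countable.dense_compl ℝ (Set.Finite.countable hfin)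
  have hγγ : γ = γ' := by
    ext j
    have h1 := f.num_β j
    rw [hnum] at h1
    exact mul_right_cancel₀ (f.denErase_β_ne_zero j) (h1.symm.trans (g.num_β j))
  subst hγγ
  have hlin : ∀ᶠ lam in Filter.cofinite, a * lam + c = a' * lam + c' := by
    filter_upwards [hnum'] with lam ⟨h1, h2⟩
    rw [num, num] at h1
    exact mul_right_cancel₀ h2 (add_right_cancel h1)
  have hlin' : (fun lam : ℝ => a * lam + c) = fun lam => a' * lam + c' := by
    refine Continuous.ext_on (s := {lam | a * lam + c = a' * lam + c'}) ?_ (by fun_prop)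
      (by fun_prop) fun _ h => h
    have hfin := Filter.mem_cofinite.1 hlin
    simpa only [compl_compl] using Set.Countable.dense_compl ℝ (Set.Finite.countable hfin)
  have hc : c = c' := by simpa using congrFun hlin' 0
  have ha1 : a = a' := by simpa [hc] using congrFun hlin' 1
  subst hc ha1
  rfl

end RatHN

theorem mclaughlin_rundell_fixed_index
    (q₁ q₂ : ℝ → ℝ)
    (hq₁ : IntegrableOn q₁ (Ioo 0 Real.pi))
    (hq₂ : IntegrableOn q₂ (Ioo 0 Real.pi))
    (f₁ f₂ : RatHN) (k : ℕ) (hk : 1 ≤ k)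
    (b : ℕ → ℝ) (hb : Function.Injective b)
    (h : ∀ j : ℕ, ∃ Λ₁ Λ₂ : ℕ → ℝ,
      IsEnum (eigenvalues q₁ f₁ (some (b j))) Λ₁ ∧
      IsEnum (eigenvalues q₂ f₂ (some (b j))) Λ₂ ∧
      Λ₁ k = Λ₂ k) :
    (∀ᵐ x : ℝ ∂volume, x ∈ Ioo 0 Real.pi → q₁ x = q₂ x) ∧ f₁ = f₂ := by
  have hi₁ := (intervalIntegrable_iff_integrableOn_Ioo_of_le Real.pi_pos.le).2 hq₁
  have hi₂ := (intervalIntegrable_iff_integrableOn_Ioo_of_le Real.pi_pos.le).2 hq₂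
  have hw := SturmLiouville.weyl_eq hi₁ hi₂ f₁ f₂ hk hb h
  exact ⟨SturmLiouville.ae_eq_of_weyl_eq hi₁ hi₂ hw,
    RatHN.ext_of_num_mul_den_eq (SturmLiouville.num_mul_den_eq hi₁ hi₂ hw)⟩
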